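/- Let A be a unital commutative ℝ-algebra generated by a linear subspace V ⊆ A, L a normalized linear functional on A, Q a quadratic module in A, and q a Hilbertian seminorm on A such that {α ∈ K_Q : α|_V is q-continuous} ≠ ∅. Suppose: (a) L(Q) ⊆ [0,∞); (b) for each v ∈ V, ∑_{n=1}^∞ L(v^{2n})^{-1/(2n)} = ∞; and (c) tr(s_L|_V / q) < ∞. Then there exists a unique representing Radon measure ν for L with support contained in {α ∈ K_Q : α|_V is q-continuous}. -/

import Mathlib

open MeasureTheory
open scoped ENNReal

noncomputable section

/-- The character space `X(A)` of a unital commutative `ℝ`-algebra `A`: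
the set of `ℝ`-algebra homomorphisms `A → ℝ`. -/
abbrev Character (A : Type*) [CommRing A] [Algebra ℝ A] := A →ₐ[ℝ] ℝ

/-- The weak topology on the character space: the weakest topology making all
evaluations `α ↦ α a` continuous. -/
instance Character.instTopologicalSpace (A : Type*) [CommRing A] [Algebra ℝ A] :
    TopologicalSpace (Character A) :=
  TopologicalSpace.induced (fun (α : Character A) (a : A) => α a) inferInstance

/-- The Borel σ-algebra on the character space. -/
instance Character.instMeasurableSpace (A : Type*) [CommRing A] [Algebra ℝ A] :
    MeasurableSpace (Character A) :=
  borel (Character A)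

/-- A Radon measure: a locally finite Borel measure that is inner regular with
respect to compact sets. -/
def IsRadonMeasure {X : Type*} [TopologicalSpace X] [MeasurableSpace X]
    (μ : Measure X) : Prop :=
  IsLocallyFiniteMeasure μ ∧ μ.InnerRegularWRT IsCompact MeasurableSet

/-- A Hilbertian seminorm on a real vector space `V`: a seminorm induced by a
symmetric positive semidefinite bilinear form, recorded by the form itself. -/
structure HilbSeminorm (V : Type*) [AddCommGroup V] [Module ℝ V] where
  bilin : V →ₗ[ℝ] V →ₗ[ℝ] ℝ
  symm : ∀ v w, bilin v w = bilin w v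
  nonneg : ∀ v, 0 ≤ bilin v v

namespace HilbSeminorm

variable {V W : Type*} [AddCommGroup V] [Module ℝ V] [AddCommGroup W] [Module ℝ W]

/-- The seminorm associated to a Hilbertian seminorm: `p v = √⟨v,v⟩ₚ`. -/
def toFun (p : HilbSeminorm V) (v : V) : ℝ := Real.sqrt (p.bilin v v)

/-- Pullback of a Hilbertian seminorm along a linear map (e.g. restriction to a
subspace along the inclusion). -/
def comp (p : HilbSeminorm V) (f : W →ₗ[ℝ] V) : HilbSeminorm W where
  bilin := LinearMap.compl₁₂ p.bilin f f
  symm v w := by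
    simp only [LinearMap.compl₁₂_apply]
    exact p.symm (f v) (f w)
  nonneg v := by
    simp only [LinearMap.compl₁₂_apply]
    exact p.nonneg (f v)

/-- The Hilbertian seminorm `c • p`, induced by the bilinear form `c² ⟨·,·⟩ₚ`. -/
def smul (p : HilbSeminorm V) (c : ℝ) : HilbSeminorm V where
  bilin := c ^ 2 • p.bilin
  symm v w := by
    simp only [LinearMap.smul_apply, smul_eq_mul]
    rw [p.symm v w]
  nonneg v := by
    simp only [LinearMap.smul_apply, smul_eq_mul]
    exact mul_nonneg (sq_nonneg c) (p.nonneg v)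

/-- A finite subset `E ⊆ V` is `q`-orthonormal. -/
def IsONS (q : HilbSeminorm V) (E : Finset V) : Prop :=
  (∀ e ∈ E, q.bilin e e = 1) ∧ ∀ e ∈ E, ∀ f ∈ E, e ≠ f → q.bilin e f = 0

open scoped Classical

/-- The trace `tr(p/q)` of a Hilbertian seminorm `p` with respect to a Hilbertian
seminorm `q`: the supremum over finite `q`-orthonormal sets `E` of `∑_{e∈E} p(e)²`
if `ker q ⊆ ker p`, and `∞` otherwise. -/
def trace (p q : HilbSeminorm V) : ℝ≥0∞ :=
  if ∀ v, q.bilin v v = 0 → p.bilin v v = 0 then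
    ⨆ (E : Finset V) (_ : q.IsONS E), ENNReal.ofReal (∑ e ∈ E, p.bilin e e)
  else ⊤

end HilbSeminorm

section AlgebraDefs

variable {A : Type*} [CommRing A] [Algebra ℝ A]

/-- The restriction `α|_V` of a character `α` is `q`-continuous. -/
def QContOn (V : Submodule ℝ A) (q : ↥V → ℝ) (α : Character A) : Prop :=
  ∃ C > 0, ∀ v : V, |α (v : A)| ≤ C * q v

/-- `J`: the family of all subalgebras of `A` generated by finite-dimensional
subspaces of `V`. -/
def finGenSubalgebras (V : Submodule ℝ A) : Set (Subalgebra ℝ A) :=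
  {S | ∃ W : Submodule ℝ A, W ≤ V ∧ FiniteDimensional ℝ ↥W ∧
    S = Algebra.adjoin ℝ (W : Set A)}

/-- The family `{ν_S : S ∈ J}` is `p`-concentrated. -/
def Concentrated (V : Submodule ℝ A) (J : Set (Subalgebra ℝ A)) (p : ↥V → ℝ)
    (ν : ∀ S : Subalgebra ℝ A, Measure (Character ↥S)) : Prop :=
  ∀ ε > (0 : ℝ), ∃ δ > (0 : ℝ), ∀ S ∈ J, ∀ v : V, ∀ hv : (v : A) ∈ S,
    p v ≤ δ → ν S {α : Character ↥S | 1 ≤ |α ⟨(v : A), hv⟩|} ≤ ENNReal.ofReal ε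

/-- A quadratic module in `A`. -/
def IsQuadraticModule (Q : Set A) : Prop :=
  (1 : A) ∈ Q ∧ (∀ x ∈ Q, ∀ y ∈ Q, x + y ∈ Q) ∧ ∀ a : A, ∀ x ∈ Q, a ^ 2 * x ∈ Q

/-- The nonnegativity set `K_Q ⊆ X(A)` of a quadratic module `Q`. -/
def charNonneg (Q : Set A) : Set (Character A) := {α | ∀ a ∈ Q, 0 ≤ α a}

/-- The nonnegativity set `K_{Q ∩ S} ⊆ X(S)` for a subalgebra `S`. -/
def charNonnegOn (Q : Set A) (S : Subalgebra ℝ A) : Set (Character ↥S) :=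
  {α | ∀ a : S, (a : A) ∈ Q → 0 ≤ α a}

/-- The Hilbertian seminorm `s_L(a) = √(L(a²))` induced by a `∑A²`-positive
linear functional `L`, via the bilinear form `(a,b) ↦ L(ab)`. -/
def sLSeminorm (L : A →ₗ[ℝ] ℝ) (hL : ∀ a : A, 0 ≤ L (a * a)) : HilbSeminorm A where
  bilin := (LinearMap.mul ℝ A).compr₂ L
  symm v w := by simp [mul_comm]
  nonneg v := by simpa using hL v

end AlgebraDefs

/-- `τ` is the topology induced by a directed family `P` of Hilbertian
seminorms. -/
def InducedByHilbFamily {V : Type*} [AddCommGroup V] [Module ℝ V]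
    (τ : TopologicalSpace V) (P : Set (HilbSeminorm V)) : Prop :=
  (∀ p ∈ P, ∀ q ∈ P, ∃ r ∈ P, ∀ v, p.toFun v ≤ r.toFun v ∧ q.toFun v ≤ r.toFun v) ∧
  ∀ v : V, (@nhds V τ v).HasBasis
    (fun pe : HilbSeminorm V × ℝ => pe.1 ∈ P ∧ 0 < pe.2)
    (fun pe => {w | pe.1.toFun (w - v) < pe.2})

/-- A topology is nuclear (in the sense of Yamasaki) if it is induced by a
directed family `P` of Hilbertian seminorms such that every `p ∈ P` admits
`q ∈ P` with `tr(p/q) < ∞`. -/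
def IsNuclearTopology {V : Type*} [AddCommGroup V] [Module ℝ V]
    (τ : TopologicalSpace V) : Prop :=
  ∃ P : Set (HilbSeminorm V), InducedByHilbFamily τ P ∧
    ∀ p ∈ P, ∃ q ∈ P, p.trace q < ⊤

end

open Finset in
/-- Telescoping identity behind Carleman's inequality. -/
theorem sum_weighted_average (r : ℕ → ℝ) (N : ℕ) :
    ∑ n ∈ range N, (∑ j ∈ range (n + 1), ((j : ℝ) + 1) * r j) / (((n : ℝ) + 1) * (n + 2)) =
      ∑ j ∈ range N, r j - (∑ j ∈ range N, ((j : ℝ) + 1) * r j) / (N + 1) := by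
  induction N with
  | zero => simp
  | succ N ih =>
    rw [sum_range_succ, ih, sum_range_succ _ N, sum_range_succ r N]
    push_cast
    field_simp
    ring

/-- The geometric mean of `n + 1` nonnegative numbers is bounded by a weighted average. -/
theorem geom_mean_le_weighted_average (r : ℕ → ℝ) (hr : ∀ j, 0 ≤ r j) (n : ℕ) :
    (∏ j ∈ Finset.range (n + 1), r j) ^ ((1 : ℝ) / (n + 1)) ≤
      2 * Real.exp 1 *
        ((∑ j ∈ Finset.range (n + 1), ((j : ℝ) + 1) * r j) / (((n : ℝ) + 1) * (n + 2))) := by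
  have hn : (0 : ℝ) < n + 1 := by positivity
  have hAM := Real.geom_mean_le_arith_mean (Finset.range (n + 1)) (fun _ => (1 : ℝ))
    (fun j => ((j : ℝ) + 1) * r j) (fun _ _ => zero_le_one) (by simp; positivity)
    (fun j _ => mul_nonneg (by positivity) (hr j))
  simp only [Real.rpow_one, Finset.prod_mul_distrib, Finset.sum_const, Finset.card_range,
    nsmul_eq_mul, mul_one, one_mul, Nat.cast_add, Nat.cast_one] at hAM
  have hfact : ∏ j ∈ Finset.range (n + 1), ((j : ℝ) + 1) = ((n + 1).factorial : ℝ) := by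
    rw [← Finset.prod_range_add_one_eq_factorial]
    push_cast
    rfl
  have hP : 0 ≤ ∏ j ∈ Finset.range (n + 1), r j := Finset.prod_nonneg fun j _ => hr j
  rw [hfact, Real.mul_rpow (by positivity) hP] at hAM
  have hst : ((n : ℝ) + 1) / Real.exp 1 ≤ ((n + 1).factorial : ℝ) ^ ((n : ℝ) + 1)⁻¹ := by
    have h := Real.pow_div_factorial_le_exp ((n : ℝ) + 1) hn.le (n + 1)
    rw [div_le_iff₀ (by positivity)] at h
    have h2 : (((n : ℝ) + 1) / Real.exp 1) ^ (n + 1) ≤ ((n + 1).factorial : ℝ) := by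
      rw [div_pow, div_le_iff₀ (by positivity), ← Real.exp_nat_mul]
      push_cast
      rw [mul_one]
      linarith
    have h3 := Real.rpow_le_rpow (by positivity) h2 (inv_nonneg.mpr hn.le)
    rwa [← Real.rpow_natCast, ← Real.rpow_mul (by positivity), Nat.cast_add, Nat.cast_one,
      mul_inv_cancel₀ hn.ne', Real.rpow_one] at h3
  set G := (∏ j ∈ Finset.range (n + 1), r j) ^ ((n : ℝ) + 1)⁻¹ with hG
  have hG0 : 0 ≤ G := Real.rpow_nonneg hP _
  rw [one_div, ← hG]
  set S := ∑ j ∈ Finset.range (n + 1), ((j : ℝ) + 1) * r j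
  have h4 : ((n : ℝ) + 1) / Real.exp 1 * G ≤ S / (n + 1) :=
    (mul_le_mul_of_nonneg_right hst hG0).trans hAM
  have hS : 0 ≤ S := Finset.sum_nonneg fun j _ => mul_nonneg (by positivity) (hr j)
  have he : 0 < Real.exp 1 := Real.exp_pos 1
  have h5 : G ≤ Real.exp 1 * (S / ((n + 1) * (n + 1))) := by
    have : G = Real.exp 1 / (n + 1) * (((n : ℝ) + 1) / Real.exp 1 * G) := by field_simp
    rw [this]
    calc _ ≤ Real.exp 1 / (n + 1) * (S / (n + 1)) := by gcongr
      _ = _ := by field_simp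
  refine h5.trans ?_
  rw [mul_comm 2, mul_assoc]
  gcongr
  rw [← mul_div_assoc, div_le_div_iff₀ (by positivity) (by positivity)]
  nlinarith [mul_nonneg hS hn.le, mul_nonneg (mul_nonneg hS hn.le) (Nat.cast_nonneg (α := ℝ) n)]

/-- A form of **Carleman's inequality**. -/
theorem carleman_inequality (r : ℕ → ℝ) (hr : ∀ j, 0 ≤ r j) (N : ℕ) :
    ∑ n ∈ Finset.range N, (∏ j ∈ Finset.range (n + 1), r j) ^ ((1 : ℝ) / (n + 1)) ≤
      2 * Real.exp 1 * ∑ j ∈ Finset.range N, r j := by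
  calc _ ≤ ∑ n ∈ Finset.range N, 2 * Real.exp 1 *
        ((∑ j ∈ Finset.range (n + 1), ((j : ℝ) + 1) * r j) / (((n : ℝ) + 1) * (n + 2))) :=
        Finset.sum_le_sum fun n _ => geom_mean_le_weighted_average r hr n
    _ ≤ _ := by
      rw [← Finset.mul_sum, sum_weighted_average]
      gcongr
      have : 0 ≤ ∑ j ∈ Finset.range N, ((j : ℝ) + 1) * r j :=
        Finset.sum_nonneg fun j _ => mul_nonneg (by positivity) (hr j)
      linarith [div_nonneg this (show (0 : ℝ) ≤ N + 1 by positivity)]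

/-- The Gelfand–Naimark–Segal construction for a functional nonnegative on squares. -/
theorem exists_gns.{u} {A : Type u} [CommRing A] [Algebra ℝ A] (L : A →ₗ[ℝ] ℝ)
    (hL : ∀ a : A, 0 ≤ L (a * a)) :
    ∃ (H : Type u) (_ : NormedAddCommGroup H) (_ : InnerProductSpace ℝ H) (_ : CompleteSpace H)
      (i : A →ₗ[ℝ] H), (∀ a b, inner ℝ (i a) (i b) = L (a * b)) ∧ DenseRange i := by
  let core : PreInnerProductSpace.Core ℝ A :=
    { inner a b := L (a * b)
      conj_inner_symm a b := by simp [mul_comm]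
      re_inner_nonneg a := by simpa using hL a
      add_left a b c := by simp [add_mul]
      smul_left a b r := by simp }
  let : SeminormedAddCommGroup A := @InnerProductSpace.Core.toSeminormedAddCommGroup ℝ A _ _ _ core
  let : InnerProductSpace ℝ A := InnerProductSpace.ofCore core
  refine ⟨UniformSpace.Completion A, inferInstance, inferInstance, inferInstance,
    (UniformSpace.Completion.toComplL (𝕜 := ℝ) (E := A)).toLinearMap, fun a b => ?_, ?_⟩
  · simp only [ContinuousLinearMap.coe_coe, UniformSpace.Completion.coe_toComplL,
      UniformSpace.Completion.inner_coe]
    rfl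
  · exact UniformSpace.Completion.denseRange_coe

section OrthogonalSequence

variable {A : Type*} [CommRing A] [Algebra ℝ A]

/-- The Cauchy–Schwarz inequality for a functional nonnegative on squares. -/
theorem sq_apply_mul_le (L : A →ₗ[ℝ] ℝ) (hL : ∀ a : A, 0 ≤ L (a * a)) (x y : A) :
    L (x * y) ^ 2 ≤ L (x * x) * L (y * y) := by
  have h : ∀ t : ℝ, 0 ≤ L (y * y) * (t * t) + 2 * L (x * y) * t + L (x * x) := by
    intro t
    have := hL (x + t • y)
    simp only [mul_add, add_mul, map_add, smul_mul_assoc, mul_smul_comm, map_smul,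
      smul_eq_mul, mul_comm y x] at this
    linarith
  have := discrim_le_zero h
  rw [discrim] at this
  linarith

/-- The monic orthogonal sequence generated by the three-term recurrence for multiplication by `v`
started at `a`. -/
noncomputable def orthoSeq (L : A →ₗ[ℝ] ℝ) (v a : A) : ℕ → A
  | 0 => 0
  | 1 => a
  | n + 2 =>
    v * orthoSeq L v a (n + 1)
      - (L (v * orthoSeq L v a (n + 1) * orthoSeq L v a (n + 1)) /
          L (orthoSeq L v a (n + 1) * orthoSeq L v a (n + 1))) • orthoSeq L v a (n + 1)
      - (L (orthoSeq L v a (n + 1) * orthoSeq L v a (n + 1)) /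
          L (orthoSeq L v a n * orthoSeq L v a n)) • orthoSeq L v a n

variable (L : A →ₗ[ℝ] ℝ) (v a : A)

theorem mul_orthoSeq (n : ℕ) : v * orthoSeq L v a (n + 1) = orthoSeq L v a (n + 2)
    + (L (v * orthoSeq L v a (n + 1) * orthoSeq L v a (n + 1)) /
        L (orthoSeq L v a (n + 1) * orthoSeq L v a (n + 1))) • orthoSeq L v a (n + 1)
    + (L (orthoSeq L v a (n + 1) * orthoSeq L v a (n + 1)) /
        L (orthoSeq L v a n * orthoSeq L v a n)) • orthoSeq L v a n := by
  rw [orthoSeq]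
  abel

theorem orthoSeq_orthogonal (hL : ∀ a : A, 0 ≤ L (a * a)) :
    ∀ n, ∀ m < n, L (orthoSeq L v a n * orthoSeq L v a m) = 0 := by
  have hnull : ∀ x y : A, L (x * x) = 0 → L (y * x) = 0 := fun x y h => by
    have := sq_apply_mul_le L hL y x
    rw [h, mul_zero] at this
    exact pow_eq_zero_iff two_ne_zero |>.mp (le_antisymm this (sq_nonneg _))
  intro n
  induction n using Nat.strong_induction_on with
  | _ n ih =>
    match n with
    | 0 => simp
    | 1 => intro m hm; simp [show m = 0 by omega, orthoSeq]
    | n + 2 =>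
      have ihs : ∀ j < n + 2, ∀ k < n + 2, j ≠ k →
          L (orthoSeq L v a j * orthoSeq L v a k) = 0 := by
        intro j hj k hk hjk
        rcases lt_or_gt_of_ne hjk with h | h
        · rw [mul_comm]; exact ih k hk j h
        · exact ih j hj k h
      intro m hm
      rw [orthoSeq]
      simp only [sub_mul, map_sub, smul_mul_assoc, map_smul, smul_eq_mul]
      rcases Nat.lt_succ_iff_lt_or_eq.mp hm with hm' | rfl
      · match m with
        | 0 => simp [orthoSeq]
        | m + 1 =>
          rw [ihs (n + 1) (by omega) (m + 1) (by omega) (by omega)]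
          have hcomm : v * orthoSeq L v a (n + 1) * orthoSeq L v a (m + 1) =
              orthoSeq L v a (n + 1) * (v * orthoSeq L v a (m + 1)) := by ring
          have hm1 : L (v * orthoSeq L v a (n + 1) * orthoSeq L v a (m + 1)) =
              L (orthoSeq L v a (n + 1) * orthoSeq L v a (m + 2)) := by
            rw [hcomm, mul_orthoSeq]
            simp only [mul_add, map_add, mul_smul_comm, map_smul, smul_eq_mul]
            rw [ihs (n + 1) (by omega) (m + 1) (by omega) (by omega),
              ihs (n + 1) (by omega) m (by omega) (by omega)]
            ring
          rcases Nat.lt_succ_iff_lt_or_eq.mp hm' with h | rfl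
          · rw [hm1, ihs (n + 1) (by omega) (m + 2) (by omega) (by omega),
              ihs n (by omega) (m + 1) (by omega) (by omega)]
            ring
          · rw [hm1, mul_zero, sub_zero]
            rcases eq_or_ne (L (orthoSeq L v a (m + 1) * orthoSeq L v a (m + 1))) 0 with h0 | h0
            · have : L (orthoSeq L v a (m + 1 + 1) * orthoSeq L v a (m + 2)) = 0 := by
                rw [← hm1]; exact hnull _ _ h0
              rw [this, h0]; ring
            · rw [div_mul_cancel₀ _ h0, sub_self]
      · rw [ihs n (by omega) (n + 1) (by omega) (by omega), mul_zero, sub_zero]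
        rcases eq_or_ne (L (orthoSeq L v a (n + 1) * orthoSeq L v a (n + 1))) 0 with h0 | h0
        · rw [hnull _ _ h0, h0]; ring
        · rw [div_mul_cancel₀ _ h0, sub_self]

theorem apply_pow_mul_orthoSeq (hL : ∀ a : A, 0 ≤ L (a * a))
    (hpos : ∀ n, 0 < L (orthoSeq L v a (n + 1) * orthoSeq L v a (n + 1))) (n : ℕ) :
    L (v ^ n * a * orthoSeq L v a (n + 1)) = L (orthoSeq L v a (n + 1) * orthoSeq L v a (n + 1)) ∧
      ∀ m > n + 1, L (v ^ n * a * orthoSeq L v a m) = 0 := by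
  induction n with
  | zero =>
    refine ⟨by simp [orthoSeq], fun m hm => ?_⟩
    rw [pow_zero, one_mul, mul_comm]
    exact orthoSeq_orthogonal L v a hL m 1 hm
  | succ n ih =>
    have key : ∀ j, v ^ (n + 1) * a * orthoSeq L v a j = v ^ n * a * (v * orthoSeq L v a j) :=
      fun j => by ring
    obtain ⟨ih1, ih2⟩ := ih
    refine ⟨?_, fun m hm => ?_⟩
    · rw [key, mul_orthoSeq]
      simp only [mul_add, map_add, mul_smul_comm, map_smul, smul_eq_mul]
      rw [ih2 (n + 1 + 2) (by omega), ih2 (n + 1 + 1) (by omega), ih1,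
        div_mul_cancel₀ _ (hpos n).ne']
      ring
    · obtain ⟨m, rfl⟩ : ∃ j, m = j + 1 := ⟨m - 1, by omega⟩
      rw [key, mul_orthoSeq]
      simp only [mul_add, map_add, mul_smul_comm, map_smul, smul_eq_mul]
      rw [ih2 (m + 2) (by omega), ih2 (m + 1) (by omega), ih2 m (by omega)]
      ring

theorem apply_orthoSeq_sq_le (hL : ∀ a : A, 0 ≤ L (a * a))
    (hpos : ∀ n, 0 < L (orthoSeq L v a (n + 1) * orthoSeq L v a (n + 1))) (n : ℕ) :
    L (orthoSeq L v a (n + 1) * orthoSeq L v a (n + 1)) ≤ L (a ^ 2 * v ^ (2 * n)) := by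
  have h := sq_apply_mul_le L hL (v ^ n * a) (orthoSeq L v a (n + 1))
  rw [(apply_pow_mul_orthoSeq L v a hL hpos n).1, sq] at h
  rw [show a ^ 2 * v ^ (2 * n) = v ^ n * a * (v ^ n * a) by ring]
  exact le_of_mul_le_mul_right h (hpos n)

end OrthogonalSequence

/-- A discrete Wronskian of two sequences coupled by a three-term recurrence grows at least like
the weights of the recurrence. -/
theorem mul_le_wronskian (h F G α : ℕ → ℝ) (hF0 : F 0 = 0) (hG0 : G 0 = 0)
    (hF : ∀ n, G (n + 1) = F (n + 2) + α n * F (n + 1) + h (n + 1) / h n * F n)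
    (hG : ∀ n, -F (n + 1) = G (n + 2) + α n * G (n + 1) + h (n + 1) / h n * G n) (n : ℕ)
    (hpos : ∀ k ≤ n, 0 < h (k + 1)) :
    h (n + 1) * ((F 1 ^ 2 + G 1 ^ 2) / h 1) ≤ F (n + 2) * G (n + 1) - F (n + 1) * G (n + 2) := by
  have hstep : ∀ n, F (n + 2) * G (n + 1) - F (n + 1) * G (n + 2) =
      F (n + 1) ^ 2 + G (n + 1) ^ 2 + h (n + 1) / h n * (F (n + 1) * G n - F n * G (n + 1)) := by
    intro n
    have h1 := hF n
    have h2 := hG n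
    have e1 : F (n + 2) = G (n + 1) - α n * F (n + 1) - h (n + 1) / h n * F n := by linarith
    have e2 : G (n + 2) = -F (n + 1) - α n * G (n + 1) - h (n + 1) / h n * G n := by linarith
    rw [e1, e2]
    ring
  induction n with
  | zero =>
    rw [hstep, hF0, hG0, zero_add, mul_div_cancel₀ _ (hpos 0 le_rfl).ne']
    simp
  | succ n ih =>
    rw [hstep]
    have h1 := ih fun k hk => hpos k (by omega)
    have h2 := hpos n (by omega)
    have h3 := hpos (n + 1) le_rfl
    have h4 := mul_le_mul_of_nonneg_left h1 (div_pos h3 h2).le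
    have e : h (n + 1 + 1) / h (n + 1) * (h (n + 1) * ((F 1 ^ 2 + G 1 ^ 2) / h 1)) =
        h (n + 1 + 1) * ((F 1 ^ 2 + G 1 ^ 2) / h 1) := by field_simp
    rw [e] at h4
    have := sq_nonneg (F (n + 1 + 1))
    have := sq_nonneg (G (n + 1 + 1))
    linarith

/-- Under Carleman's condition on the weights, coupled square-summable solutions of a three-term
recurrence vanish at the first index. -/
theorem eq_zero_of_carleman (h F G α m : ℕ → ℝ) (hF0 : F 0 = 0) (hG0 : G 0 = 0)
    (hF : ∀ n, G (n + 1) = F (n + 2) + α n * F (n + 1) + h (n + 1) / h n * F n)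
    (hG : ∀ n, -F (n + 1) = G (n + 2) + α n * G (n + 1) + h (n + 1) / h n * G n)
    (hpos : ∀ n, 0 < h (n + 1)) (C : ℝ)
    (hC : ∀ N, ∑ n ∈ Finset.range N, (F (n + 1) ^ 2 + G (n + 1) ^ 2) / h (n + 1) ≤ C)
    (hm : ∀ n, h (n + 1) ≤ m n)
    (hdiv : ∑' n : ℕ, (ENNReal.ofReal (m (n + 1) ^ ((1 : ℝ) / (2 * (n + 1) : ℝ))))⁻¹ = ⊤) :
    F 1 = 0 := by
  set x : ℕ → ℝ := fun n => (F (n + 1) ^ 2 + G (n + 1) ^ 2) / h (n + 1) with hx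
  have hx0 : ∀ n, 0 ≤ x n := fun n => div_nonneg (by positivity) (hpos n).le
  by_contra hF1
  have hx1 : 0 < x 0 := div_pos (by positivity) (hpos 0)
  set r : ℕ → ℝ := fun n => √(h (n + 1) / h (n + 2)) with hr
  have hrx : ∀ n, r n * x 0 ≤ (x n + x (n + 1)) / 2 := by
    intro n
    have h1 := mul_le_wronskian h F G α hF0 hG0 hF hG n fun k _ => hpos k
    have hp1 := hpos n
    have hp2 := hpos (n + 1)
    have hx2 := hx0 n
    have hx3 := hx0 (n + 1)
    have h2 : (h (n + 1) * x 0) ^ 2 ≤ (h (n + 2) * x (n + 1)) * (h (n + 1) * x n) := by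
      have e1 : h (n + 2) * x (n + 1) = F (n + 2) ^ 2 + G (n + 2) ^ 2 := by
        simp only [hx]; field_simp
      have e2 : h (n + 1) * x n = F (n + 1) ^ 2 + G (n + 1) ^ 2 := by
        simp only [hx]; field_simp
      rw [e1, e2]
      have h3 : (h (n + 1) * x 0) ^ 2 ≤
          (F (n + 2) * G (n + 1) - F (n + 1) * G (n + 2)) ^ 2 :=
        pow_le_pow_left₀ (by positivity) h1 2
      nlinarith [sq_nonneg (F (n + 2) * F (n + 1) + G (n + 1) * G (n + 2))]
    refine abs_le_of_sq_le_sq' ?_ (by positivity) |>.2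
    rw [mul_pow, hr, Real.sq_sqrt (by positivity)]
    have h4 : h (n + 1) / h (n + 2) * x 0 ^ 2 ≤ x (n + 1) * x n := by
      rw [div_mul_eq_mul_div, div_le_iff₀ hp2]
      have := le_of_mul_le_mul_left (a := h (n + 1))
        (b := h (n + 1) * x 0 ^ 2) (c := x (n + 1) * x n * h (n + 2)) (by nlinarith) hp1
      exact this
    nlinarith [sq_nonneg (x n - x (n + 1))]
  have hsum : ∀ N, ∑ n ∈ Finset.range N, r n ≤ C / x 0 := by
    intro N
    rw [le_div_iff₀ hx1, Finset.sum_mul]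
    calc _ ≤ ∑ n ∈ Finset.range N, (x n + x (n + 1)) / 2 := Finset.sum_le_sum fun n _ => hrx n
      _ = (∑ n ∈ Finset.range N, x n + ∑ n ∈ Finset.range N, x (n + 1)) / 2 := by
        rw [← Finset.sum_div, Finset.sum_add_distrib]
      _ ≤ C := by
        have h1 := hC N
        have h2 := hC (N + 1)
        rw [Finset.sum_range_succ'] at h2
        have := hx0 0
        simp only [hx] at this ⊢
        linarith
  have hprod : ∀ n, ∏ j ∈ Finset.range (n + 1), r j = √(h 1 / h (n + 2)) := by
    intro n
    induction n with
    | zero => simp [hr]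
    | succ n ih =>
      rw [Finset.prod_range_succ, ih, hr, ← Real.sqrt_mul (div_nonneg (hpos 0).le (hpos _).le)]
      congr 1
      have := (hpos (n + 1)).ne'
      field_simp
  set c := min 1 (h 1) with hc
  have hc0 : 0 < c := lt_min one_pos (hpos 0)
  have hgm : ∀ n : ℕ, c * (m (n + 1) ^ ((1 : ℝ) / (2 * (n + 1) : ℝ)))⁻¹ ≤
      (∏ j ∈ Finset.range (n + 1), r j) ^ ((1 : ℝ) / (n + 1)) := by
    intro n
    have hp2 := hpos (n + 1)
    have hp0 := hpos 0
    have hm1 := hm (n + 1)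
    rw [hprod, Real.sqrt_eq_rpow, ← Real.rpow_mul (by positivity)]
    have e : (1 : ℝ) / 2 * (1 / (n + 1)) = 1 / (2 * (n + 1)) := by field_simp
    rw [e]
    set t : ℝ := 1 / (2 * (n + 1)) with ht
    have ht0 : 0 ≤ t := by positivity
    have ht1 : t ≤ 1 := by
      rw [ht, div_le_one (by positivity)]
      linarith [Nat.cast_nonneg (α := ℝ) n]
    calc c * (m (n + 1) ^ t)⁻¹ ≤ h 1 ^ t * (m (n + 1) ^ t)⁻¹ := by
          refine mul_le_mul_of_nonneg_right ?_
            (inv_nonneg.mpr (Real.rpow_nonneg (hp2.le.trans hm1) _))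
          calc c = c ^ (1 : ℝ) := (Real.rpow_one _).symm
            _ ≤ c ^ t := Real.rpow_le_rpow_of_exponent_ge hc0 (min_le_left _ _) ht1
            _ ≤ h 1 ^ t := Real.rpow_le_rpow hc0.le (min_le_right _ _) ht0
      _ = (h 1 / m (n + 1)) ^ t := by
          rw [Real.div_rpow hp0.le (hp2.le.trans hm1), div_eq_mul_inv]
      _ ≤ _ := by
          refine Real.rpow_le_rpow (div_nonneg hp0.le (hp2.le.trans hm1)) ?_ ht0
          exact div_le_div_of_nonneg_left hp0.le hp2 hm1
  have hbd : ∀ N, ∑ n ∈ Finset.range N, (m (n + 1) ^ ((1 : ℝ) / (2 * (n + 1) : ℝ)))⁻¹ ≤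
      2 * Real.exp 1 * (C / x 0) / c := by
    intro N
    rw [le_div_iff₀ hc0, mul_comm, Finset.mul_sum]
    calc _ ≤ _ := Finset.sum_le_sum fun n _ => hgm n
      _ ≤ _ := carleman_inequality r (fun j => Real.sqrt_nonneg _) N
      _ ≤ _ := mul_le_mul_of_nonneg_left (hsum N) (by positivity)
  have hle : ∑' n : ℕ, (ENNReal.ofReal (m (n + 1) ^ ((1 : ℝ) / (2 * (n + 1) : ℝ))))⁻¹ ≤
      ENNReal.ofReal (2 * Real.exp 1 * (C / x 0) / c) := by
    refine ENNReal.tsum_le_of_sum_range_le fun N => ?_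
    have hmp : ∀ n : ℕ, 0 < m (n + 1) ^ ((1 : ℝ) / (2 * (n + 1) : ℝ)) := fun n =>
      Real.rpow_pos_of_pos ((hpos _).trans_le (hm _)) _
    simp_rw [← ENNReal.ofReal_inv_of_pos (hmp _)]
    rw [← ENNReal.ofReal_sum_of_nonneg fun n _ => (inv_pos.mpr (hmp n)).le]
    exact ENNReal.ofReal_le_ofReal (hbd N)
  rw [hdiv] at hle
  exact absurd hle (by simp)

/-- Vanishing of vectors orthogonal to the range of the map `(p, q) ↦ (vp + q, vq - p)`. -/
theorem inner_eq_zero_of_carleman {A : Type*} [CommRing A] [Algebra ℝ A] (L : A →ₗ[ℝ] ℝ)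
    (hL : ∀ a : A, 0 ≤ L (a * a)) {H : Type*} [NormedAddCommGroup H] [InnerProductSpace ℝ H]
    (i : A →ₗ[ℝ] H) (hi : ∀ a b, inner ℝ (i a) (i b) = L (a * b)) (v a : A)
    (hdiv : ∑' n : ℕ, (ENNReal.ofReal (L (a ^ 2 * v ^ (2 * (n + 1))) ^
      ((1 : ℝ) / (2 * (n + 1) : ℝ))))⁻¹ = ⊤)
    (f g : H) (hfg : ∀ p q, inner ℝ f (i (v * p + q)) + inner ℝ g (i (v * q - p)) = 0) :
    inner ℝ f (i a) = 0 := by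
  set R := orthoSeq L v a with hR
  set h : ℕ → ℝ := fun n => L (R n * R n) with hh
  set F : ℕ → ℝ := fun n => inner ℝ f (i (R n)) with hFdef
  set G : ℕ → ℝ := fun n => inner ℝ g (i (R n)) with hGdef
  have hF0 : F 0 = 0 := by simp [hFdef, hR, orthoSeq]
  have hG0 : G 0 = 0 := by simp [hGdef, hR, orthoSeq]
  have hcs : ∀ (k : H) (n : ℕ), inner ℝ k (i (R n)) ^ 2 ≤ ‖k‖ ^ 2 * h n := by
    intro k n
    simp only [hh]
    rw [← hi, real_inner_self_eq_norm_sq, ← mul_pow]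
    exact sq_le_sq' (abs_le.mp (abs_real_inner_le_norm _ _)).1
      (abs_le.mp (abs_real_inner_le_norm _ _)).2
  have hF : ∀ n, G (n + 1) = F (n + 2) + L (v * R (n + 1) * R (n + 1)) / h (n + 1) * F (n + 1)
      + h (n + 1) / h n * F n := by
    intro n
    have h1 := hfg (R (n + 1)) 0
    rw [add_zero, mul_zero, zero_sub, hR, mul_orthoSeq, map_neg, inner_neg_right] at h1
    simp only [map_add, map_smul, inner_add_right, real_inner_smul_right] at h1
    simp only [hFdef, hGdef, hh, hR]
    linarith
  have hG : ∀ n, -F (n + 1) = G (n + 2) + L (v * R (n + 1) * R (n + 1)) / h (n + 1) * G (n + 1)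
      + h (n + 1) / h n * G n := by
    intro n
    have h1 := hfg 0 (R (n + 1))
    rw [sub_zero, mul_zero, zero_add, hR, mul_orthoSeq] at h1
    simp only [map_add, map_smul, inner_add_right, real_inner_smul_right] at h1
    simp only [hFdef, hGdef, hh, hR]
    linarith
  change F 1 = 0
  by_cases hpos : ∀ n, 0 < h (n + 1)
  · refine eq_zero_of_carleman h F G _ (fun n => L (a ^ 2 * v ^ (2 * n))) hF0 hG0 hF hG hpos
      (‖f‖ ^ 2 + ‖g‖ ^ 2) (fun N => ?_) (apply_orthoSeq_sq_le L v a hL hpos) hdiv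
    have hon : Orthonormal ℝ fun n => (√(h (n + 1)))⁻¹ • i (R (n + 1)) := by
      refine ⟨fun n => ?_, fun m n hmn => ?_⟩
      · rw [norm_smul, norm_inv, Real.norm_of_nonneg (Real.sqrt_nonneg _),
          show ‖i (R (n + 1))‖ = √(h (n + 1)) by
            simp only [hh]
            rw [← hi, real_inner_self_eq_norm_sq, Real.sqrt_sq (norm_nonneg _)]]
        exact inv_mul_cancel₀ (Real.sqrt_pos.mpr (hpos n)).ne'
      · dsimp only
        rw [real_inner_smul_left, real_inner_smul_right, hi]
        have : L (R (m + 1) * R (n + 1)) = 0 := by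
          rcases lt_or_gt_of_ne hmn with hlt | hlt
          · rw [mul_comm]
            exact orthoSeq_orthogonal L v a hL _ _ (by omega)
          · exact orthoSeq_orthogonal L v a hL _ _ (by omega)
        rw [this]
        ring
    have hB : ∀ k : H, ∑ n ∈ Finset.range N, inner ℝ k (i (R (n + 1))) ^ 2 / h (n + 1) ≤
        ‖k‖ ^ 2 := by
      intro k
      refine le_trans (le_of_eq (Finset.sum_congr rfl fun n _ => ?_))
        (hon.sum_inner_products_le k (s := Finset.range N))
      rw [real_inner_smul_left, Real.norm_eq_abs, sq_abs, mul_pow, inv_pow,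
        Real.sq_sqrt (hpos n).le, real_inner_comm]
      ring
    calc _ = ∑ n ∈ Finset.range N, F (n + 1) ^ 2 / h (n + 1) +
          ∑ n ∈ Finset.range N, G (n + 1) ^ 2 / h (n + 1) := by
          rw [← Finset.sum_add_distrib]
          exact Finset.sum_congr rfl fun n _ => add_div _ _ _
      _ ≤ _ := add_le_add (hB f) (hB g)
  · push Not at hpos
    obtain ⟨k, hk, hlt⟩ : ∃ k, h (k + 1) = 0 ∧ ∀ j < k, 0 < h (j + 1) := by
      classical
      exact ⟨Nat.find hpos, le_antisymm (Nat.find_spec hpos) (hL _),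
        fun j hj => not_le.mp (Nat.find_min hpos hj)⟩
    have hFk : F (k + 1) = 0 := by
      have := hcs f (k + 1)
      rw [hk, mul_zero] at this
      exact pow_eq_zero_iff two_ne_zero |>.mp (le_antisymm this (sq_nonneg _))
    have hGk : G (k + 1) = 0 := by
      have := hcs g (k + 1)
      rw [hk, mul_zero] at this
      exact pow_eq_zero_iff two_ne_zero |>.mp (le_antisymm this (sq_nonneg _))
    rcases k with _ | n
    · exact hFk
    · have h1 := mul_le_wronskian h F G _ hF0 hG0 hF hG n fun j hj => hlt j (by omega)
      rw [hFk, hGk, zero_mul, mul_zero, sub_zero] at h1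
      have h2 : (F 1 ^ 2 + G 1 ^ 2) / h 1 ≤ 0 := nonpos_of_mul_nonpos_right h1 (hlt n (by omega))
      have h3 : 0 < h 1 := hlt 0 (by omega)
      rw [div_le_iff₀ h3, zero_mul] at h2
      have := sq_nonneg (G 1)
      exact pow_eq_zero_iff two_ne_zero |>.mp (le_antisymm (by linarith) (sq_nonneg _))

/-- Carleman's condition makes `1 + v²` act with dense range, in graph form. -/
theorem exists_approx_of_carleman {A : Type*} [CommRing A] [Algebra ℝ A] (L : A →ₗ[ℝ] ℝ)
    (hL : ∀ a : A, 0 ≤ L (a * a)) (v a : A)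
    (hdiv : ∑' n : ℕ, (ENNReal.ofReal (L (a ^ 2 * v ^ (2 * (n + 1))) ^
      ((1 : ℝ) / (2 * (n + 1) : ℝ))))⁻¹ = ⊤) (ε : ℝ) (hε : 0 < ε) :
    ∃ p q, L ((v * p + q - a) * (v * p + q - a)) < ε ∧ L ((v * q - p) * (v * q - p)) < ε := by
  obtain ⟨H, _, _, _, i, hi, -⟩ := exists_gns L hL
  let T : A × A →ₗ[ℝ] WithLp 2 (H × H) := (WithLp.linearEquiv 2 ℝ (H × H)).symm.toLinearMap ∘ₗ
    { toFun := fun x => (i (v * x.1 + x.2), i (v * x.2 - x.1))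
      map_add' := fun x y => by
        ext <;> simp [mul_add] <;> abel
      map_smul' := fun c x => by
        ext <;> simp [smul_sub] }
  have hT : ∀ p q, T (p, q) = WithLp.toLp 2 (i (v * p + q), i (v * q - p)) := fun p q => rfl
  have hmem : WithLp.toLp 2 (i a, (0 : H)) ∈ (LinearMap.range T).topologicalClosure := by
    rw [← Submodule.orthogonal_orthogonal_eq_closure, Submodule.mem_orthogonal]
    intro u hu
    rw [Submodule.mem_orthogonal'] at hu
    rw [WithLp.prod_inner_apply]
    simp only [inner_zero_right, add_zero]
    refine inner_eq_zero_of_carleman L hL i hi v a hdiv u.fst u.snd fun p q => ?_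
    have := hu _ (LinearMap.mem_range_self T (p, q))
    rwa [hT, WithLp.prod_inner_apply] at this
  rw [← SetLike.mem_coe, Submodule.topologicalClosure_coe, Metric.mem_closure_iff] at hmem
  obtain ⟨_, ⟨⟨p, q⟩, rfl⟩, hd⟩ := hmem (√ε) (Real.sqrt_pos.mpr hε)
  have hd2 : ‖T (p, q) - WithLp.toLp 2 (i a, (0 : H))‖ ^ 2 < ε := by
    rw [dist_comm, dist_eq_norm] at hd
    calc _ < √ε ^ 2 := pow_lt_pow_left₀ hd (norm_nonneg _) two_ne_zero
      _ = ε := Real.sq_sqrt hε.le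
  rw [hT, WithLp.prod_norm_sq_eq_of_L2] at hd2
  change ‖i (v * p + q) - i a‖ ^ 2 + ‖i (v * q - p) - 0‖ ^ 2 < ε at hd2
  rw [sub_zero] at hd2
  have e1 : ‖i (v * p + q) - i a‖ ^ 2 = L ((v * p + q - a) * (v * p + q - a)) := by
    rw [← map_sub, ← real_inner_self_eq_norm_sq, hi]
  have e2 : ‖i (v * q - p)‖ ^ 2 = L ((v * q - p) * (v * q - p)) := by
    rw [← real_inner_self_eq_norm_sq, hi]
  rw [e1, e2] at hd2
  exact ⟨p, q, by linarith [hL (v * q - p)], by linarith [hL (v * p + q - a)]⟩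

section Denominators

variable {A : Type*} [CommRing A] [Algebra ℝ A]

theorem apply_add_sq_le (L : A →ₗ[ℝ] ℝ) (hL : ∀ a : A, 0 ≤ L (a * a)) (x y : A) :
    L ((x + y) * (x + y)) ≤ 2 * L (x * x) + 2 * L (y * y) := by
  have h := hL (x - y)
  have e : (x + y) * (x + y) + (x - y) * (x - y) = (2 : ℝ) • (x * x) + (2 : ℝ) • (y * y) := by
    simp only [two_smul]; ring
  have h2 := congrArg L e
  simp only [map_add, map_smul, smul_eq_mul] at h2
  linarith

/-- The elements by which multiplication has dense range in every weighted `L²`-seminorm. -/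
def denominators (L : A →ₗ[ℝ] ℝ) (hL : ∀ a : A, 0 ≤ L (a * a)) : Submonoid A where
  carrier := {m | ∀ c a : A, ∀ ε > (0 : ℝ), ∃ q, L ((c * (m * q - a)) * (c * (m * q - a))) < ε}
  one_mem' c a ε hε := ⟨a, by simpa using hε⟩
  mul_mem' {m m'} hm hm' c a ε hε := by
    obtain ⟨q, hq⟩ := hm c a (ε / 4) (by positivity)
    obtain ⟨q', hq'⟩ := hm' (c * m) q (ε / 4) (by positivity)
    refine ⟨q', ?_⟩
    have e : c * (m * m' * q' - a) = c * m * (m' * q' - q) + c * (m * q - a) := by ring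
    rw [e]
    linarith [apply_add_sq_le L hL (c * m * (m' * q' - q)) (c * (m * q - a))]

theorem ENNReal.tsum_odd_eq_top (w : ℕ → ℝ≥0∞) (hw : Antitone w) (h0 : w 0 ≠ ⊤)
    (h : ∑' n, w n = ⊤) : ∑' n, w (2 * n + 1) = ⊤ := by
  rw [tsum_eq_zero_add' ENNReal.summable, ← tsum_even_add_odd ENNReal.summable ENNReal.summable]
    at h
  by_contra hne
  have hle : ∑' n, w (2 * n + 1 + 1) ≤ ∑' n, w (2 * n + 1) :=
    ENNReal.tsum_le_tsum fun n => hw (Nat.le_succ _)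
  exact (ENNReal.add_ne_top.mpr ⟨h0, ENNReal.add_ne_top.mpr ⟨hne, ne_top_of_le_ne_top hne hle⟩⟩) h

theorem moment_pow_le (L : A →ₗ[ℝ] ℝ) (hL : ∀ a : A, 0 ≤ L (a * a)) (hL1 : L 1 = 1) (v : A)
    (n : ℕ) : L (v ^ (2 * n)) ^ (n + 1) ≤ L (v ^ (2 * (n + 1))) ^ n := by
  have h0 : ∀ n, 0 ≤ L (v ^ (2 * n)) := fun n => by
    rw [two_mul, pow_add]; exact hL _
  induction n with
  | zero => simp [hL1]
  | succ n ih =>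
    have hcs := sq_apply_mul_le L hL (v ^ n) (v ^ (n + 2))
    rw [← pow_add, ← pow_add, ← pow_add, show n + (n + 2) = 2 * (n + 1) by ring,
      show n + n = 2 * n by ring, show n + 2 + (n + 2) = 2 * (n + 1 + 1) by ring] at hcs
    rcases (h0 (n + 1)).eq_or_lt with h | h
    · rw [← h, zero_pow (by omega)]
      exact pow_nonneg (h0 _) _
    · have h1 := pow_le_pow_left₀ (sq_nonneg _) hcs (n + 1)
      rw [mul_pow, ← pow_mul] at h1
      have h2 := h1.trans (mul_le_mul_of_nonneg_right ih (pow_nonneg (h0 (n + 1 + 1)) (n + 1)))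
      rw [show 2 * (n + 1) = n + (n + 1 + 1) by ring, pow_add] at h2
      rw [show n + (n + 1 + 1) = 2 * (n + 1) by ring] at h2
      exact le_of_mul_le_mul_left h2 (pow_pos h n)

theorem rpow_moment_mono (L : A →ₗ[ℝ] ℝ) (hL : ∀ a : A, 0 ≤ L (a * a)) (hL1 : L 1 = 1) (v : A) :
    Monotone fun n : ℕ => L (v ^ (2 * (n + 1))) ^ ((1 : ℝ) / (2 * (n + 1) : ℝ)) := by
  have h0 : ∀ n, 0 ≤ L (v ^ (2 * n)) := fun n => by
    rw [two_mul, pow_add]; exact hL _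
  refine monotone_nat_of_le_succ fun n => ?_
  have h := Real.rpow_le_rpow (pow_nonneg (h0 _) _) (moment_pow_le L hL hL1 v (n + 1))
    (z := 1 / (2 * (n + 1) * (n + 2))) (by positivity)
  rw [← Real.rpow_natCast, ← Real.rpow_natCast, ← Real.rpow_mul (h0 _), ← Real.rpow_mul (h0 _)] at h
  have e1 : ((n + 1 + 1 : ℕ) : ℝ) * (1 / (2 * (n + 1) * (n + 2))) = 1 / (2 * (n + 1)) := by
    push_cast
    rw [show (n : ℝ) + 1 + 1 = n + 2 by ring]
    field_simp
  have e2 : ((n + 1 : ℕ) : ℝ) * (1 / (2 * (n + 1) * (n + 2))) = 1 / (2 * ((n + 1 : ℕ) + 1)) := by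
    push_cast
    rw [show (n : ℝ) + 1 + 1 = n + 2 by ring]
    field_simp
  rwa [e1, e2] at h

theorem tsum_even_moments_eq_top (L : A →ₗ[ℝ] ℝ) (hL : ∀ a : A, 0 ≤ L (a * a)) (hL1 : L 1 = 1)
    (v : A) (h : ∑' n : ℕ, (ENNReal.ofReal ((L (v ^ (2 * (n + 1)))) ^
      ((1 : ℝ) / (2 * (n + 1) : ℝ))))⁻¹ = ⊤) :
    ∑' n : ℕ, (ENNReal.ofReal ((L (v ^ (2 * (2 * n + 1 + 1)))) ^
      ((1 : ℝ) / (2 * ((2 * n + 1 : ℕ) + 1) : ℝ))))⁻¹ = ⊤ := by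
  set w : ℕ → ℝ≥0∞ := fun n => (ENNReal.ofReal ((L (v ^ (2 * (n + 1)))) ^
      ((1 : ℝ) / (2 * (n + 1) : ℝ))))⁻¹ with hw
  change ∑' n, w (2 * n + 1) = ⊤
  by_cases h0 : w 0 = ⊤
  · have hv : L (v * v) = 0 := by
      refine le_antisymm ?_ (hL v)
      by_contra hpos
      rw [hw] at h0
      simp only [ENNReal.inv_eq_top, ENNReal.ofReal_eq_zero] at h0
      refine absurd h0 (not_le.mpr (Real.rpow_pos_of_pos ?_ _))
      rw [show 2 * (0 + 1) = 2 by rfl, sq]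
      exact not_le.mp hpos
    refine ENNReal.tsum_eq_top_of_eq_top ⟨0, ?_⟩
    have : L (v ^ (2 * (2 * 0 + 1 + 1))) = 0 := by
      have hcs := sq_apply_mul_le L hL v (v ^ 3)
      rw [hv, zero_mul] at hcs
      rw [show v ^ (2 * (2 * 0 + 1 + 1)) = v * v ^ 3 by ring]
      exact pow_eq_zero_iff two_ne_zero |>.mp (le_antisymm hcs (sq_nonneg _))
    simp only [hw]
    rw [this, Real.zero_rpow (by positivity)]
    simp
  · refine ENNReal.tsum_odd_eq_top w (fun m n hmn => ?_) h0 h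
    exact ENNReal.inv_le_inv.mpr (ENNReal.ofReal_le_ofReal (rpow_moment_mono L hL hL1 v hmn))

theorem tsum_weighted_moments_eq_top (L : A →ₗ[ℝ] ℝ) (hL : ∀ a : A, 0 ≤ L (a * a))
    (hL1 : L 1 = 1) (v d : A) (h : ∑' n : ℕ, (ENNReal.ofReal ((L (v ^ (2 * (n + 1)))) ^
      ((1 : ℝ) / (2 * (n + 1) : ℝ))))⁻¹ = ⊤) :
    ∑' n : ℕ, (ENNReal.ofReal ((L (d * v ^ (2 * (n + 1)))) ^
      ((1 : ℝ) / (2 * (n + 1) : ℝ))))⁻¹ = ⊤ := by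
  have h0 : ∀ n, 0 ≤ L (v ^ (2 * n)) := fun n => by
    rw [two_mul, pow_add]; exact hL _
  set K : ℝ := max 1 √(L (d * d)) with hK
  have hK1 : 1 ≤ K := le_max_left _ _
  have hterm : ∀ n : ℕ, (ENNReal.ofReal K)⁻¹ * (ENNReal.ofReal ((L (v ^ (2 * (2 * n + 1 + 1)))) ^
      ((1 : ℝ) / (2 * ((2 * n + 1 : ℕ) + 1) : ℝ))))⁻¹ ≤
      (ENNReal.ofReal ((L (d * v ^ (2 * (n + 1)))) ^ ((1 : ℝ) / (2 * (n + 1) : ℝ))))⁻¹ := by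
    intro n
    rw [← ENNReal.mul_inv (Or.inr ENNReal.ofReal_ne_top) (Or.inl ENNReal.ofReal_ne_top),
      ← ENNReal.ofReal_mul (by positivity)]
    refine ENNReal.inv_le_inv.mpr (ENNReal.ofReal_le_ofReal ?_)
    have ht0 : (0 : ℝ) ≤ 1 / (2 * (n + 1)) := by positivity
    have ht1 : (1 : ℝ) / (2 * (n + 1)) ≤ 1 := by
      rw [div_le_one (by positivity)]
      linarith [Nat.cast_nonneg (α := ℝ) n]
    have hle : |L (d * v ^ (2 * (n + 1)))| ≤ K * √(L (v ^ (2 * (2 * n + 1 + 1)))) := by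
      calc _ ≤ √(L (d * d) * L (v ^ (2 * (n + 1)) * v ^ (2 * (n + 1)))) :=
            Real.abs_le_sqrt (sq_apply_mul_le L hL _ _)
        _ = √(L (d * d)) * √(L (v ^ (2 * (2 * n + 1 + 1)))) := by
            rw [Real.sqrt_mul (hL d), ← pow_add]
            congr 4
            ring
        _ ≤ _ := mul_le_mul_of_nonneg_right (le_max_right _ _) (Real.sqrt_nonneg _)
    calc L (d * v ^ (2 * (n + 1))) ^ ((1 : ℝ) / (2 * (n + 1)))
        ≤ |L (d * v ^ (2 * (n + 1)))| ^ ((1 : ℝ) / (2 * (n + 1))) :=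
          (le_abs_self _).trans (Real.abs_rpow_le_abs_rpow _ _)
      _ ≤ (K * √(L (v ^ (2 * (2 * n + 1 + 1))))) ^ ((1 : ℝ) / (2 * (n + 1))) :=
          Real.rpow_le_rpow (abs_nonneg _) hle ht0
      _ = K ^ ((1 : ℝ) / (2 * (n + 1))) * L (v ^ (2 * (2 * n + 1 + 1))) ^
          ((1 : ℝ) / (2 * ((2 * n + 1 : ℕ) + 1) : ℝ)) := by
          rw [Real.mul_rpow (by positivity) (Real.sqrt_nonneg _), Real.sqrt_eq_rpow,
            ← Real.rpow_mul (h0 _)]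
          congr 2
          push_cast
          field_simp
          ring
      _ ≤ _ := by
          refine mul_le_mul_of_nonneg_right ?_ (Real.rpow_nonneg (h0 _) _)
          calc _ ≤ K ^ (1 : ℝ) := Real.rpow_le_rpow_of_exponent_le hK1 ht1
            _ = K := Real.rpow_one _
  refine top_unique (le_trans (le_of_eq ?_) (ENNReal.tsum_le_tsum hterm))
  rw [ENNReal.tsum_mul_left, tsum_even_moments_eq_top L hL hL1 v h, ENNReal.mul_top]
  simp

theorem one_add_sq_mem_denominators (L : A →ₗ[ℝ] ℝ) (hL : ∀ a : A, 0 ≤ L (a * a))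
    (hL1 : L 1 = 1) (v : A) (h : ∑' n : ℕ, (ENNReal.ofReal ((L (v ^ (2 * (n + 1)))) ^
      ((1 : ℝ) / (2 * (n + 1) : ℝ))))⁻¹ = ⊤) : 1 + v * v ∈ denominators L hL := by
  intro c a ε hε
  let L' : A →ₗ[ℝ] ℝ := L ∘ₗ LinearMap.mulLeft ℝ (c * c * (1 + v * v))
  have hL'x : ∀ x, L' x = L (c * c * (1 + v * v) * x) := fun x => rfl
  have hsq : ∀ x, L' (x * x) = L (c * x * (c * x)) + L (c * v * x * (c * v * x)) := fun x => by
    rw [hL'x, ← map_add]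
    congr 1
    ring
  have hL' : ∀ x, 0 ≤ L' (x * x) := fun x => by
    rw [hsq]
    exact add_nonneg (hL _) (hL _)
  obtain ⟨p, q, h1, h2⟩ := exists_approx_of_carleman L' hL' v a (by
    simp_rw [hL'x, ← mul_assoc (c * c * (1 + v * v))]
    exact tsum_weighted_moments_eq_top L hL hL1 v _ h) (ε / 4) (by positivity)
  refine ⟨q, ?_⟩
  rw [show c * ((1 + v * v) * q - a) = c * v * (v * q - p) + c * (v * p + q - a) by ring]
  rw [hsq] at h1 h2
  have h3 := apply_add_sq_le L hL (c * v * (v * q - p)) (c * (v * p + q - a))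
  linarith [hL (c * (v * q - p)), hL (c * v * (v * p + q - a))]

end Denominators

section ArchimedeanCone

/-- An Archimedean multiplicative convex cone in a commutative real algebra. -/
structure IsArchimedeanCone {C : Type*} [CommRing C] [Algebra ℝ C] (P : Set C) : Prop where
  one_mem : (1 : C) ∈ P
  add_mem : ∀ x ∈ P, ∀ y ∈ P, x + y ∈ P
  smul_mem : ∀ r : ℝ, 0 ≤ r → ∀ x ∈ P, r • x ∈ P
  mul_mem : ∀ x ∈ P, ∀ y ∈ P, x * y ∈ P
  arch : ∀ x : C, ∃ N : ℝ, 0 < N ∧ N • 1 + x ∈ P ∧ N • 1 - x ∈ P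

variable {C : Type*} [CommRing C] [Algebra ℝ C]

/-- The characters that are nonnegative on a set `P`. -/
abbrev PosCharacter (P : Set C) := {φ : Character C // ∀ p ∈ P, 0 ≤ φ p}

/-- The states of a cone, as a set of functions. -/
def coneStates (P : Set C) : Set (C → ℝ) :=
  {f | (∀ x y, f (x + y) = f x + f y) ∧ (∀ (r : ℝ) x, f (r • x) = r * f x) ∧ f 1 = 1 ∧
    ∀ p ∈ P, 0 ≤ f p}

theorem coneStates_abs_le {P : Set C} {f : C → ℝ} (hf : f ∈ coneStates P) {x : C} {N : ℝ}
    (h1 : N • 1 + x ∈ P) (h2 : N • 1 - x ∈ P) : |f x| ≤ N := by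
  obtain ⟨ha, hs, ho, hp⟩ := hf
  have e1 := hp _ h1
  have e2 := hp _ h2
  rw [ha, hs, ho] at e1
  rw [sub_eq_add_neg, ha, hs, ho, ← neg_one_smul ℝ x, hs] at e2
  exact abs_le.mpr ⟨by linarith, by linarith⟩

theorem isClosed_coneStates (P : Set C) : IsClosed (coneStates P) := by
  have e : coneStates P = (⋂ x, ⋂ y, {f : C → ℝ | f (x + y) = f x + f y}) ∩
      ((⋂ r : ℝ, ⋂ x, {f : C → ℝ | f (r • x) = r * f x}) ∩ ({f : C → ℝ | f 1 = 1} ∩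
        ⋂ p ∈ P, {f : C → ℝ | 0 ≤ f p})) := by
    ext f
    simp [coneStates]
  rw [e]
  refine .inter (isClosed_iInter fun x => isClosed_iInter fun y => ?_) (.inter
    (isClosed_iInter fun r => isClosed_iInter fun x => ?_) (.inter ?_
      (isClosed_iInter fun p => isClosed_iInter fun _ => ?_)))
  · exact isClosed_eq (by fun_prop) (by fun_prop)
  · exact isClosed_eq (by fun_prop) (by fun_prop)
  · exact isClosed_eq (by fun_prop) (by fun_prop)
  · exact isClosed_le (by fun_prop) (by fun_prop)

theorem isCompact_coneStates {P : Set C} (hP : IsArchimedeanCone P) :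
    IsCompact (coneStates P) := by
  choose N hN0 hN1 hN2 using hP.arch
  refine (isCompact_univ_pi fun x => isCompact_Icc (a := -N x) (b := N x)).of_isClosed_subset
    (isClosed_coneStates P) fun f hf x _ => ?_
  exact abs_le.mp (coneStates_abs_le hf (hN1 x) (hN2 x))

theorem convex_coneStates (P : Set C) : Convex ℝ (coneStates P) := by
  rintro f ⟨fa, fs, f1, fp⟩ g ⟨ga, gs, g1, gp⟩ s t hs ht hst
  refine ⟨fun x y => ?_, fun r x => ?_, ?_, fun p hp => ?_⟩ <;>
    simp only [Pi.add_apply, Pi.smul_apply, smul_eq_mul]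
  · rw [fa, ga]; ring
  · rw [fs, gs]; ring
  · rw [f1, g1]; linarith
  · exact add_nonneg (mul_nonneg hs (fp p hp)) (mul_nonneg ht (gp p hp))

theorem coneStates_mul_of_extreme {P : Set C} (hP : IsArchimedeanCone P) {f : C → ℝ}
    (hf : f ∈ Set.extremePoints ℝ (coneStates P)) (x y : C) : f (x * y) = f x * f y := by
  rw [mem_extremePoints] at hf
  obtain ⟨⟨fa, fs, f1, fp⟩, hext⟩ := hf
  have fneg : ∀ z, f (-z) = - f z := fun z => by rw [← neg_one_smul ℝ z, fs]; ring
  have fsub : ∀ z w, f (z - w) = f z - f w := fun z w => by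
    rw [sub_eq_add_neg, fa, fneg]; ring
  have hzero : ∀ z ∈ P, f z = 0 → ∀ w, f (z * w) = 0 := by
    intro z hz hz0 w
    obtain ⟨M, -, h1, h2⟩ := hP.arch w
    have e1 := fp _ (hP.mul_mem _ hz _ h1)
    have e2 := fp _ (hP.mul_mem _ hz _ h2)
    rw [mul_add, mul_smul_comm, mul_one, fa, fs, hz0] at e1
    rw [mul_sub, mul_smul_comm, mul_one, fsub, fs, hz0] at e2
    linarith
  have key : ∀ z, z ∈ P → 1 - z ∈ P → ∀ w, f (z * w) = f z * f w := by
    intro z hz hz' w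
    have h1z : f (1 - z) = 1 - f z := by rw [fsub, f1]
    rcases (fp z hz).eq_or_lt with h0 | h0
    · rw [hzero z hz h0.symm, ← h0, zero_mul]
    have h1' := fp _ hz'
    rcases h1'.eq_or_lt with h1 | h1
    · have := hzero _ hz' h1.symm w
      rw [sub_mul, one_mul, fsub] at this
      rw [h1z] at h1
      rw [show f z = 1 by linarith]
      linarith
    have hg : (fun w => f (z * w) / f z) ∈ coneStates P := by
      refine ⟨fun a b => ?_, fun r a => ?_, ?_, fun p hp => ?_⟩
      · dsimp only; rw [mul_add, fa, add_div]
      · dsimp only; rw [mul_smul_comm, fs, mul_div_assoc]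
      · dsimp only; rw [mul_one, div_self h0.ne']
      · exact div_nonneg (fp _ (hP.mul_mem _ hz _ hp)) h0.le
    have hh : (fun w => f ((1 - z) * w) / f (1 - z)) ∈ coneStates P := by
      refine ⟨fun a b => ?_, fun r a => ?_, ?_, fun p hp => ?_⟩
      · dsimp only; rw [mul_add, fa, add_div]
      · dsimp only; rw [mul_smul_comm, fs, mul_div_assoc]
      · dsimp only; rw [mul_one, div_self h1.ne']
      · exact div_nonneg (fp _ (hP.mul_mem _ hz' _ hp)) h1.le
    have := (hext _ hg _ hh ⟨f z, f (1 - z), h0, h1, by rw [h1z]; ring, by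
      funext w
      simp only [Pi.add_apply, Pi.smul_apply, smul_eq_mul]
      rw [mul_div_cancel₀ _ h0.ne', mul_div_cancel₀ _ h1.ne', ← fa]
      congr 1
      ring⟩).1
    have h2 := congrFun this w
    rw [div_eq_iff h0.ne'] at h2
    rw [h2, mul_comm]
  obtain ⟨N, hN, h1, h2⟩ := hP.arch x
  have hz : (1 / (2 * N)) • (N • 1 + x) ∈ P := hP.smul_mem _ (by positivity) _ h1
  have hz' : (1 : C) - (1 / (2 * N)) • (N • 1 + x) ∈ P := by
    have : (1 : C) - (1 / (2 * N)) • (N • 1 + x) = (1 / (2 * N)) • (N • 1 - x) := by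
      rw [smul_add, smul_sub, smul_smul, show 1 / (2 * N) * N = 1 / 2 by field_simp]
      nth_rewrite 1 [← one_smul ℝ (1 : C)]
      module
    rw [this]
    exact hP.smul_mem _ (by positivity) _ h2
  have h := key _ hz hz' y
  rw [smul_mul_assoc, fs, fs, add_mul, smul_mul_assoc, one_mul, fa, fa, fs, fs, f1] at h
  field_simp at h
  linarith

/-- A functional nonnegative on an Archimedean cone is nonnegative on every element that is
nonnegative at all positive characters. -/
theorem nonneg_of_forall_posCharacter {P : Set C} (hP : IsArchimedeanCone P) (Λ : C →ₗ[ℝ] ℝ)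
    (hΛ : ∀ x ∈ P, 0 ≤ Λ x) (b : C) (hb : ∀ φ : PosCharacter P, 0 ≤ φ.1 b) : 0 ≤ Λ b := by
  have hstate : ∀ f ∈ coneStates P, 0 ≤ f b := by
    intro f hf
    rw [← closure_convexHull_extremePoints (isCompact_coneStates hP) (convex_coneStates P)] at hf
    have hcl : IsClosed {f : C → ℝ | 0 ≤ f b} := isClosed_le (by fun_prop) (by fun_prop)
    have hcv : Convex ℝ {f : C → ℝ | 0 ≤ f b} := by
      intro f hf g hg s t hs ht _
      exact add_nonneg (mul_nonneg hs hf) (mul_nonneg ht hg)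
    refine closure_minimal (convexHull_min (fun g hg => ?_) hcv) hcl hf
    obtain ⟨ga, gs, g1, gp⟩ := (extremePoints_subset hg)
    let φ : Character C := AlgHom.ofLinearMap ⟨⟨g, ga⟩, gs⟩ g1
      fun x y => coneStates_mul_of_extreme hP hg x y
    exact hb ⟨φ, gp⟩
  rcases (hΛ 1 hP.one_mem).eq_or_lt with h0 | h0
  · obtain ⟨N, -, h1, -⟩ := hP.arch b
    have := hΛ _ h1
    rw [map_add, map_smul, ← h0, smul_zero, zero_add] at this
    exact this
  · have := hstate (fun x => Λ x / Λ 1) ⟨fun x y => by simp only [map_add, add_div], fun r x => by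
      simp only [map_smul, smul_eq_mul, mul_div_assoc], div_self h0.ne', fun p hp =>
      div_nonneg (hΛ p hp) h0.le⟩
    have h := mul_nonneg this h0.le
    rwa [div_mul_cancel₀ _ h0.ne'] at h

instance Character.instBorelSpace (A : Type*) [CommRing A] [Algebra ℝ A] :
    BorelSpace (Character A) := ⟨rfl⟩

theorem Character.isInducing (A : Type*) [CommRing A] [Algebra ℝ A] :
    Topology.IsInducing (fun (α : Character A) (a : A) => α a) := ⟨rfl⟩

theorem Character.continuous_eval {A : Type*} [CommRing A] [Algebra ℝ A] (a : A) :
    Continuous fun α : Character A => α a :=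
  (continuous_apply a).comp (Character.isInducing A).continuous

instance Character.instT2Space (A : Type*) [CommRing A] [Algebra ℝ A] : T2Space (Character A) :=
  T2Space.of_injective_continuous (f := fun (α : Character A) (a : A) => α a)
    (fun _ _ h => AlgHom.ext fun a => congrFun h a) (Character.isInducing A).continuous

theorem compactSpace_posCharacter {P : Set C} (hP : IsArchimedeanCone P) :
    CompactSpace (PosCharacter P) := by
  have hind : Topology.IsInducing (fun (φ : PosCharacter P) (a : C) => φ.1 a) :=
    (Character.isInducing C).comp Topology.IsInducing.subtypeVal
  rw [← isCompact_univ_iff, hind.isCompact_iff, Set.image_univ]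
  have e : Set.range (fun (φ : PosCharacter P) (a : C) => φ.1 a) =
      coneStates P ∩ ⋂ x, ⋂ y, {f : C → ℝ | f (x * y) = f x * f y} := by
    ext f
    simp only [Set.mem_range, Set.mem_inter_iff, Set.mem_iInter, Set.mem_ofPred_eq]
    constructor
    · rintro ⟨φ, rfl⟩
      exact ⟨⟨fun x y => map_add _ _ _, fun r x => map_smul φ.1 r x, map_one _, φ.2⟩,
        fun x y => map_mul _ _ _⟩
    · rintro ⟨⟨ga, gs, g1, gp⟩, gm⟩
      exact ⟨⟨AlgHom.ofLinearMap ⟨⟨f, ga⟩, gs⟩ g1 gm, gp⟩, rfl⟩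
  rw [e]
  refine (isCompact_coneStates hP).inter_right (isClosed_iInter fun x => isClosed_iInter fun y => ?_)
  exact isClosed_eq (by fun_prop) (by fun_prop)

/-- Evaluation of elements of the algebra as continuous functions on the positive characters. -/
def evalPosCharacter (P : Set C) : C →ₐ[ℝ] C(PosCharacter P, ℝ) where
  toFun b := ⟨fun φ => φ.1 b, (Character.continuous_eval b).comp continuous_subtype_val⟩
  map_one' := by ext; simp
  map_mul' x y := by ext; simp
  map_zero' := by ext; simp
  map_add' x y := by ext; simp
  commutes' r := by ext φ; simp

theorem denseRange_evalPosCharacter {P : Set C} (hP : IsArchimedeanCone P) :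
    DenseRange (evalPosCharacter P) := by
  have := compactSpace_posCharacter hP
  have h := ContinuousMap.subalgebra_topologicalClosure_eq_top_of_separatesPoints
    (evalPosCharacter P).range (by
      intro φ ψ hne
      obtain ⟨b, hb⟩ : ∃ b, φ.1 b ≠ ψ.1 b := by
        by_contra hcon
        push Not at hcon
        exact hne (Subtype.ext (AlgHom.ext hcon))
      exact ⟨_, ⟨_, ⟨b, rfl⟩, rfl⟩, hb⟩)
  intro g
  have hg : g ∈ (evalPosCharacter P).range.topologicalClosure := by rw [h]; trivial
  exact hg

theorem exists_measure_of_positive {X : Type*} [TopologicalSpace X] [CompactSpace X] [T2Space X]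
    [MeasurableSpace X] [BorelSpace X] (Λ : C(X, ℝ) →ₗ[ℝ] ℝ) (hΛ : ∀ f, 0 ≤ f → 0 ≤ Λ f) :
    ∃ μ : Measure X, μ.Regular ∧ IsFiniteMeasure μ ∧ ∀ f, Λ f = ∫ x, f x ∂μ := by
  let e : CompactlySupportedContinuousMap X ℝ →ₗ[ℝ] C(X, ℝ) :=
    { toFun := fun f => f.toContinuousMap
      map_add' := fun f g => rfl
      map_smul' := fun r f => rfl }
  let Λ' : CompactlySupportedContinuousMap X ℝ →ₚ[ℝ] ℝ :=
    PositiveLinearMap.mk₀ (Λ ∘ₗ e) fun f hf => hΛ _ hf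
  refine ⟨RealRMK.rieszMeasure Λ', inferInstance, inferInstance, fun f => ?_⟩
  exact (RealRMK.integral_rieszMeasure Λ'
    (CompactlySupportedContinuousMap.continuousMapEquiv f)).symm

/-- Integral representation of functionals nonnegative on an Archimedean cone. -/
theorem exists_measure_posCharacter {P : Set C} (hP : IsArchimedeanCone P) (Λ : C →ₗ[ℝ] ℝ)
    (hΛ : ∀ x ∈ P, 0 ≤ Λ x) :
    ∃ μ : Measure (PosCharacter P), μ.Regular ∧ IsFiniteMeasure μ ∧
      ∀ b, Λ b = ∫ φ, φ.1 b ∂μ := by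
  have := compactSpace_posCharacter hP
  have hbd : ∀ x, ‖Λ x‖ ≤ Λ 1 * ‖evalPosCharacter P x‖ := by
    intro x
    set n := ‖evalPosCharacter P x‖
    have hx : ∀ φ : PosCharacter P, |φ.1 x| ≤ n := fun φ =>
      (evalPosCharacter P x).norm_coe_le_norm φ
    have h1 := nonneg_of_forall_posCharacter hP Λ hΛ (n • 1 - x) fun φ => by
      rw [map_sub, map_smul, map_one, smul_eq_mul, mul_one]
      linarith [(abs_le.mp (hx φ)).2]
    have h2 := nonneg_of_forall_posCharacter hP Λ hΛ (n • 1 + x) fun φ => by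
      rw [map_add, map_smul, map_one, smul_eq_mul, mul_one]
      linarith [(abs_le.mp (hx φ)).1]
    rw [map_sub, map_smul, smul_eq_mul] at h1
    rw [map_add, map_smul, smul_eq_mul] at h2
    rw [Real.norm_eq_abs]
    exact abs_le.mpr ⟨by linarith, by linarith⟩
  have hext : ∀ x, Λ.extendOfNorm (evalPosCharacter P).toLinearMap (evalPosCharacter P x) = Λ x :=
    LinearMap.extendOfNorm_eq (e := (evalPosCharacter P).toLinearMap)
      (denseRange_evalPosCharacter hP) ⟨_, hbd⟩
  obtain ⟨μ, h1, h2, h3⟩ := exists_measure_of_positive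
    (Λ.extendOfNorm (evalPosCharacter P).toLinearMap).toLinearMap fun f hf => by
      let g : C(PosCharacter P, ℝ) := ⟨fun φ => √(f φ), by fun_prop⟩
      have hfg : f = g * g := by
        ext φ
        exact (Real.mul_self_sqrt (hf φ)).symm
      rw [hfg]
      have hcl : IsClosed {g : C(PosCharacter P, ℝ) |
          0 ≤ Λ.extendOfNorm (evalPosCharacter P).toLinearMap (g * g)} :=
        isClosed_le continuous_const (by fun_prop)
      refine (denseRange_evalPosCharacter hP).induction_on (p := fun g =>
        0 ≤ Λ.extendOfNorm (evalPosCharacter P).toLinearMap (g * g)) g hcl fun b => ?_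
      rw [← map_mul, hext]
      exact nonneg_of_forall_posCharacter hP Λ hΛ _ fun φ => by
        rw [map_mul]; exact mul_self_nonneg _
  exact ⟨μ, h1, h2, fun b => by rw [← hext]; exact h3 _⟩

/-- Regular finite measures on a compact space that agree on a point-separating algebra of
continuous functions coincide. -/
theorem measure_eq_of_separating {X : Type*} [TopologicalSpace X] [CompactSpace X] [T2Space X]
    [MeasurableSpace X] [BorelSpace X] (S : Subalgebra ℝ C(X, ℝ)) (hS : S.SeparatesPoints)
    (μ ν : Measure X) [μ.Regular] [ν.Regular] [IsFiniteMeasure μ] [IsFiniteMeasure ν]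
    (h : ∀ f ∈ S, ∫ x, f x ∂μ = ∫ x, f x ∂ν) : μ = ν := by
  have hcont : ∀ ρ : Measure X, IsFiniteMeasure ρ → Continuous fun f : C(X, ℝ) => ∫ x, f x ∂ρ := by
    intro ρ _
    have h1 : ∀ f : C(X, ℝ), ∫ x, f x ∂ρ = ∫ x, ContinuousMap.toLp (E := ℝ) 1 ρ ℝ f x ∂ρ :=
      fun f => (integral_congr_ae (ContinuousMap.coeFn_toLp ρ f)).symm
    simp_rw [h1]
    exact continuous_integral.comp (ContinuousMap.toLp (E := ℝ) 1 ρ ℝ).continuous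
  have hall : ∀ f : C(X, ℝ), ∫ x, f x ∂μ = ∫ x, f x ∂ν := by
    intro f
    have hf : f ∈ S.topologicalClosure := by
      rw [ContinuousMap.subalgebra_topologicalClosure_eq_top_of_separatesPoints S hS]; trivial
    exact closure_minimal (fun g hg => h g hg) (isClosed_eq (hcont μ ‹_›) (hcont ν ‹_›)) hf
  exact Measure.ext_of_integral_eq_on_compactlySupported fun f => hall f.toContinuousMap

end ArchimedeanCone

open Filter Topology in
/-- The product of two commuting positive symmetric operators is positive. -/
theorem inner_mul_apply_nonneg {H : Type*} [NormedAddCommGroup H] [InnerProductSpace ℝ H]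
    (x y : H →L[ℝ] H) (hxy : Commute x y)
    (hxs : ∀ h k, inner ℝ (x h) k = inner ℝ h (x k))
    (hx : ∀ h, 0 ≤ inner ℝ (x h) h) (hy : ∀ h, 0 ≤ inner ℝ (y h) h) (h : H) :
    0 ≤ inner ℝ ((x * y) h) h := by
  wlog hx1 : ∀ h, inner ℝ (x h) h ≤ inner ℝ h h generalizing x
  · have hc : 0 < (‖x‖ + 1)⁻¹ := by positivity
    have key := this ((‖x‖ + 1)⁻¹ • x) (hxy.smul_left _)
      (fun h k => by
        rw [smul_apply, smul_apply, real_inner_smul_left,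
          real_inner_smul_right, hxs])
      (fun h => by
        rw [smul_apply, real_inner_smul_left]
        exact mul_nonneg hc.le (hx h))
      (fun h => by
        rw [smul_apply, real_inner_smul_left, real_inner_self_eq_norm_sq,
          inv_mul_le_iff₀ (by positivity)]
        have h1 := real_inner_le_norm (x h) h
        have h2 := mul_le_mul_of_nonneg_right (x.le_opNorm h) (norm_nonneg h)
        nlinarith [sq_nonneg ‖h‖])
    rw [smul_mul_assoc, smul_apply, real_inner_smul_left] at key
    exact nonneg_of_mul_nonneg_right key hc
  let u : ℕ → H →L[ℝ] H := fun n => (fun z => z - z * z)^[n] x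
  have hu : ∀ n, u (n + 1) = u n - u n * u n := fun n => Function.iterate_succ_apply' _ _ _
  have hprop : ∀ n, Commute (u n) y ∧ (∀ h k, inner ℝ (u n h) k = inner ℝ h (u n k)) ∧
      (∀ h, 0 ≤ inner ℝ (u n h) h) ∧ ∀ h, inner ℝ (u n h) h ≤ inner ℝ h h := by
    intro n
    induction n with
    | zero => exact ⟨hxy, hxs, hx, hx1⟩
    | succ n ih =>
      obtain ⟨ic, is, i0, i1⟩ := ih
      rw [hu]
      refine ⟨ic.sub_left (ic.mul_left ic), fun h k => ?_, fun h => ?_, fun h => ?_⟩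
      · simp [inner_sub_left, inner_sub_right, is]
      · have e1 := i0 (h - u n h)
        have e2 := i1 (u n h)
        simp only [map_sub, inner_sub_left, inner_sub_right, sub_apply,
          mul_apply_eq_comp] at e1 e2 ⊢
        have e3 : inner ℝ (u n (u n h)) h = inner ℝ (u n h) (u n h) := is _ _
        linarith
      · have e1 := i1 h
        have e3 : inner ℝ (u n (u n h)) h = inner ℝ (u n h) (u n h) := is _ _
        have e4 : 0 ≤ inner ℝ (u n h) (u n h) := real_inner_self_nonneg
        simp only [inner_sub_left, sub_apply, mul_apply_eq_comp]
        linarith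
  have hsum : ∀ n, inner ℝ ((x * y) h) h =
      ∑ k ∈ Finset.range n, inner ℝ (y (u k h)) (u k h) + inner ℝ ((u n * y) h) h := by
    intro n
    induction n with
    | zero => simp [u]
    | succ n ih =>
      rw [ih, Finset.sum_range_succ, hu, add_assoc]
      congr 1
      obtain ⟨ic, is, -⟩ := hprop n
      have : u n (y h) = y (u n h) := congrArg (fun T : H →L[ℝ] H => T h) ic.eq
      simp only [sub_mul, sub_apply, mul_apply_eq_comp,
        inner_sub_left]
      rw [is (u n (y h)) h, this]
      ring
  have hsq : ∀ n, ∑ k ∈ Finset.range n, ‖u k h‖ ^ 2 ≤ inner ℝ (x h) h := by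
    intro n
    have : inner ℝ (x h) h = ∑ k ∈ Finset.range n, ‖u k h‖ ^ 2 + inner ℝ (u n h) h := by
      induction n with
      | zero => simp [u]
      | succ n ih =>
        rw [ih, Finset.sum_range_succ, hu, add_assoc]
        congr 1
        obtain ⟨-, is, -⟩ := hprop n
        simp only [sub_apply, mul_apply_eq_comp, inner_sub_left]
        rw [is (u n h) h, real_inner_self_eq_norm_sq]
        ring
    linarith [(hprop n).2.2.1 h]
  have hlim : Tendsto (fun n => ‖u n h‖ ^ 2) atTop (𝓝 0) :=
    (summable_of_sum_range_le (fun n => sq_nonneg _) hsq).tendsto_atTop_zero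
  have hlim' : Tendsto (fun n => ‖u n h‖) atTop (𝓝 0) := by
    simpa [Function.comp_def, Real.sqrt_sq] using (Real.continuous_sqrt.tendsto _).comp hlim
  have hlim2 : Tendsto (fun n => -(‖y‖ * ‖h‖ * ‖u n h‖)) atTop (𝓝 0) := by
    simpa using (hlim'.const_mul (‖y‖ * ‖h‖)).neg
  refine le_of_tendsto' hlim2 fun n => ?_
  rw [hsum n]
  have h1 : 0 ≤ ∑ k ∈ Finset.range n, inner ℝ (y (u k h)) (u k h) :=
    Finset.sum_nonneg fun k _ => hy _
  have h2 : inner ℝ ((u n * y) h) h = inner ℝ (y h) (u n h) := (hprop n).2.1 _ _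
  have h3 := abs_le.mp (abs_real_inner_le_norm (y h) (u n h))
  have h4 := mul_le_mul_of_nonneg_right (y.le_opNorm h) (norm_nonneg (u n h))
  linarith [h3.1]

section FractionModel

/-- A commutative algebra of bounded fractions `u / m` with denominators in `M`, together with the
functionals `x ↦ ⟨x c, c⟩` for `c ∈ A`. -/
structure FractionModel {A : Type*} [CommRing A] [Algebra ℝ A] (L : A →ₗ[ℝ] ℝ) (M : Submonoid A)
    (C : Type*) [CommRing C] [Algebra ℝ C] where
  P : Set C
  cone : IsArchimedeanCone P
  IsFrac : C → A → A → Prop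
  Λ : A → C →ₗ[ℝ] ℝ
  nonneg : ∀ c, ∀ x ∈ P, 0 ≤ Λ c x
  isFrac_mul : ∀ {x y m n u w}, IsFrac x m u → IsFrac y n w → IsFrac (x * y) (m * n) (u * w)
  isFrac_add : ∀ {x y m u w}, IsFrac x m u → IsFrac y m w → IsFrac (x + y) m (u + w)
  isFrac_algebraMap : ∀ r : ℝ, IsFrac (algebraMap ℝ C r) 1 (algebraMap ℝ A r)
  isFrac_unique : ∀ {x y m n u w}, m ∈ M → n ∈ M → IsFrac x m u → IsFrac y n w →
    u * n = w * m → x = y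
  isFrac_one_add_sq : ∀ v, 1 + v * v ∈ M →
    ∃ s t, IsFrac s (1 + v * v) 1 ∧ IsFrac t (1 + v * v) v
  isFrac_pos : ∀ {x m u}, m ∈ M → IsFrac x m u → (∀ q, 0 ≤ L (u * m * (q * q))) → x ∈ P
  apply_frac_sq : ∀ {y m u}, IsFrac y m u → ∀ b, Λ m (b * (y * y)) = Λ u b
  apply_frac_mul : ∀ {x y m u}, IsFrac x m u → IsFrac y m 1 → Λ m (x * y) = L u
  apply_one : ∀ c, Λ c 1 = L (c * c)

theorem exists_fractionModel.{u} {A : Type u} [CommRing A] [Algebra ℝ A] (L : A →ₗ[ℝ] ℝ)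
    (hL : ∀ a : A, 0 ≤ L (a * a)) :
    ∃ (C : Type u) (_ : CommRing C) (_ : Algebra ℝ C),
      Nonempty (FractionModel L (denominators L hL) C) := by
  obtain ⟨H, _, _, _, i, hi, hd⟩ := exists_gns L hL
  have hdm : ∀ m ∈ denominators L hL, DenseRange fun q => i (m * q) := by
    intro m hm
    rw [Metric.denseRange_iff]
    intro h ε hε
    obtain ⟨a, ha⟩ := Metric.denseRange_iff.mp hd h (ε / 2) (by positivity)
    obtain ⟨q, hq⟩ := hm 1 a ((ε / 2) ^ 2) (by positivity)
    refine ⟨q, ?_⟩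
    rw [one_mul, ← hi, real_inner_self_eq_norm_sq, map_sub] at hq
    have h2 := lt_of_pow_lt_pow_left₀ 2 (by positivity) hq
    rw [← dist_eq_norm, dist_comm] at h2
    linarith [dist_triangle h (i a) (i (m * q))]
  have hext : ∀ m ∈ denominators L hL, ∀ x y : H →L[ℝ] H,
      (∀ q, x (i (m * q)) = y (i (m * q))) → x = y := by
    intro m hm x y hxy
    ext h
    exact congrFun ((hdm m hm).equalizer x.continuous y.continuous (funext hxy)) h
  let S : Subalgebra ℝ (H →L[ℝ] H) :=
    { carrier := {B | ∃ m ∈ denominators L hL, ∃ u, ∀ q, B (i (m * q)) = i (u * q)}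
      mul_mem' := by
        rintro B B' ⟨m, hm, u, h⟩ ⟨m', hm', u', h'⟩
        refine ⟨m * m', mul_mem hm hm', u * u', fun q => ?_⟩
        rw [mul_apply_eq_comp, show m * m' * q = m' * (m * q) by ring, h',
          show u' * (m * q) = m * (u' * q) by ring, h, mul_assoc]
      add_mem' := by
        rintro B B' ⟨m, hm, u, h⟩ ⟨m', hm', u', h'⟩
        refine ⟨m * m', mul_mem hm hm', u * m' + u' * m, fun q => ?_⟩
        rw [add_apply, show m * m' * q = m * (m' * q) by ring, h,
          show m * (m' * q) = m' * (m * q) by ring, h', ← map_add]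
        congr 1
        ring
      algebraMap_mem' := fun r => ⟨1, one_mem _, algebraMap ℝ A r, fun q => by
        rw [one_mul, Algebra.algebraMap_eq_smul_one, Algebra.algebraMap_eq_smul_one, smul_one_mul,
          map_smul]
        rfl⟩ }
  have hcomm : ∀ x y : S, x * y = y * x := by
    rintro ⟨B, m, hm, u, h⟩ ⟨B', m', hm', u', h'⟩
    refine Subtype.ext (hext (m * m') (mul_mem hm hm') _ _ fun q => ?_)
    change B (B' _) = B' (B _)
    rw [show m * m' * q = m' * (m * q) by ring, h', show u' * (m * q) = m * (u' * q) by ring, h,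
      show m' * (m * q) = m * (m' * q) by ring, h, show u * (m' * q) = m' * (u * q) by ring, h']
    congr 1
    ring
  have hsymm : ∀ x : S, ∀ h k : H, inner ℝ (x.1 h) k = inner ℝ h (x.1 k) := by
    rintro ⟨B, m, hm, u, hB⟩ h k
    refine (hdm m hm).induction_on₂ (p := fun h k => inner ℝ (B h) k = inner ℝ h (B k))
      (isClosed_eq (by fun_prop) (by fun_prop)) (fun q q' => ?_) h k
    rw [hB, hB, hi, hi]
    congr 1
    ring
  let _ : CommRing S := { (inferInstance : Ring S) with mul_comm := hcomm }
  refine ⟨S, inferInstance, S.algebra, ⟨{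
    P := {x | ∀ h, 0 ≤ inner ℝ (x.1 h) h}
    IsFrac := fun x m u => ∀ q, x.1 (i (m * q)) = i (u * q)
    Λ := fun c =>
      { toFun := fun x => inner ℝ (x.1 (i c)) (i c)
        map_add' := fun x y => inner_add_left _ _ _
        map_smul' := fun r x => real_inner_smul_left _ _ _ }
    nonneg := fun c x hx => hx _
    cone := ?_
    isFrac_mul := ?_
    isFrac_add := ?_
    isFrac_algebraMap := ?_
    isFrac_unique := ?_
    isFrac_one_add_sq := ?_
    isFrac_pos := ?_
    apply_frac_sq := ?_
    apply_frac_mul := ?_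
    apply_one := fun c => hi c c }⟩⟩
  · refine ⟨fun h => real_inner_self_nonneg, fun x hx y hy h => ?_, fun r hr x hx h => ?_,
      fun x hx y hy h => ?_, fun x => ⟨‖x.1‖ + 1, by positivity, fun h => ?_, fun h => ?_⟩⟩
    · change 0 ≤ inner ℝ (x.1 h + y.1 h) h
      rw [inner_add_left]
      exact add_nonneg (hx h) (hy h)
    · change 0 ≤ inner ℝ (r • x.1 h) h
      rw [real_inner_smul_left]
      exact mul_nonneg hr (hx h)
    · exact inner_mul_apply_nonneg x.1 y.1 (congrArg Subtype.val (hcomm x y)) (hsymm x) hx hy h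
    · change 0 ≤ inner ℝ ((‖x.1‖ + 1) • h + x.1 h) h
      rw [inner_add_left, real_inner_smul_left, real_inner_self_eq_norm_sq]
      have h1 := (abs_le.mp (abs_real_inner_le_norm (x.1 h) h)).1
      have h2 := mul_le_mul_of_nonneg_right (x.1.le_opNorm h) (norm_nonneg h)
      nlinarith [sq_nonneg ‖h‖]
    · change 0 ≤ inner ℝ ((‖x.1‖ + 1) • h - x.1 h) h
      rw [inner_sub_left, real_inner_smul_left, real_inner_self_eq_norm_sq]
      have h1 := (abs_le.mp (abs_real_inner_le_norm (x.1 h) h)).2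
      have h2 := mul_le_mul_of_nonneg_right (x.1.le_opNorm h) (norm_nonneg h)
      nlinarith [sq_nonneg ‖h‖]
  · intro x y m n u w hx hy q
    change x.1 (y.1 _) = _
    rw [show m * n * q = n * (m * q) by ring, hy, show w * (m * q) = m * (w * q) by ring, hx,
      mul_assoc]
  · intro x y m u w hx hy q
    change x.1 _ + y.1 _ = _
    rw [hx, hy, ← map_add, add_mul]
  · intro r q
    rw [one_mul, Algebra.algebraMap_eq_smul_one, Algebra.algebraMap_eq_smul_one, smul_one_mul,
      map_smul]
    rfl
  · intro x y m n u w hm hn hx hy h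
    refine Subtype.ext (hext (m * n) (mul_mem hm hn) _ _ fun q => ?_)
    nth_rewrite 2 [mul_comm m n]
    rw [mul_assoc, mul_assoc, hx, hy, ← mul_assoc, ← mul_assoc, h]
  · intro v hv
    have hbdd : ∀ u : A, (∀ q, L (u * q * (u * q)) ≤
        L ((1 + v * v) * q * ((1 + v * v) * q))) →
        ∃ s : S, ∀ q, s.1 (i ((1 + v * v) * q)) = i (u * q) := by
      intro u hu
      let e : A →ₗ[ℝ] H := i ∘ₗ LinearMap.mulLeft ℝ (1 + v * v)
      let f : A →ₗ[ℝ] H := i ∘ₗ LinearMap.mulLeft ℝ u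
      have hB : ∀ q, f.extendOfNorm e (e q) = f q := by
        refine LinearMap.extendOfNorm_eq (hdm _ hv) ⟨1, fun q => ?_⟩
        rw [one_mul]
        refine le_of_sq_le_sq ?_ (norm_nonneg _)
        rw [← real_inner_self_eq_norm_sq, ← real_inner_self_eq_norm_sq]
        change inner ℝ (i (u * q)) (i (u * q)) ≤
          inner ℝ (i ((1 + v * v) * q)) (i ((1 + v * v) * q))
        rw [hi, hi]
        exact hu q
      exact ⟨⟨f.extendOfNorm e, 1 + v * v, hv, u, hB⟩, hB⟩
    obtain ⟨s, hs⟩ := hbdd 1 fun q => by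
      have e : (1 + v * v) * q * ((1 + v * v) * q) = 1 * q * (1 * q) + v * q * (v * q) +
          v * q * (v * q) + v * v * q * (v * v * q) := by ring
      rw [e, map_add, map_add, map_add]
      linarith [hL (v * q), hL (v * v * q)]
    obtain ⟨t, ht⟩ := hbdd v fun q => by
      have e : (1 + v * v) * q * ((1 + v * v) * q) = q * q + v * q * (v * q) +
          v * q * (v * q) + v * v * q * (v * v * q) := by ring
      rw [e, map_add, map_add, map_add]
      linarith [hL (v * q), hL (v * v * q), hL q]
    exact ⟨s, t, hs, ht⟩
  · intro x m u hm hx hpos h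
    refine (hdm m hm).induction_on (p := fun h => 0 ≤ inner ℝ (x.1 h) h) h
      (isClosed_le (by fun_prop) (by fun_prop)) fun q => ?_
    rw [hx, hi, show u * q * (m * q) = u * m * (q * q) by ring]
    exact hpos q
  · intro y m u hy b
    have h1 := hy 1
    rw [mul_one, mul_one] at h1
    have e : ∀ z : H, (b * (y * y)).1 z = y.1 (b.1 (y.1 z)) := fun z => by
      rw [mul_left_comm b y y]
      rfl
    change inner ℝ ((b * (y * y)).1 (i m)) (i m) = inner ℝ (b.1 (i u)) (i u)
    rw [e, hsymm, h1]
  · intro x y m u hx hy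
    have h1 := hx 1
    have h2 := hy 1
    rw [mul_one, mul_one] at h1 h2
    change inner ℝ (x.1 (y.1 (i m))) (i m) = L u
    rw [hsymm, h1, h2, hi, one_mul]

end FractionModel

section RandomCharacter

theorem regular_of_le {X : Type*} [TopologicalSpace X] [T2Space X] [MeasurableSpace X]
    [BorelSpace X] {μ ν : Measure X} [μ.Regular] [IsFiniteMeasure μ] (h : ν ≤ μ) : ν.Regular := by
  have : IsFiniteMeasure ν := isFiniteMeasure_of_le μ h
  have : ν.InnerRegular := by
    refine ⟨fun s hs r hr => ?_⟩
    obtain ⟨K, hKs, hK, hlt⟩ := hs.exists_isCompact_sdiff_lt (measure_ne_top μ s)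
      (tsub_pos_of_lt hr).ne'
    refine ⟨K, hKs, hK, ?_⟩
    have h1 : ν s ≤ ν K + ν (s \ K) := by
      rw [measure_add_sdiff hK.measurableSet.nullMeasurableSet]
      exact measure_mono Set.subset_union_right
    by_contra hcon
    push Not at hcon
    have := ENNReal.add_lt_add_of_le_of_lt (measure_ne_top ν K) hcon ((h _).trans_lt hlt)
    rw [add_tsub_cancel_of_le hr.le] at this
    exact absurd h1 (not_le.mpr this)
  infer_instance

theorem regular_withDensity_ofReal {X : Type*} [TopologicalSpace X] [CompactSpace X] [T2Space X]
    [MeasurableSpace X] [BorelSpace X] (μ : Measure X) [μ.Regular] [IsFiniteMeasure μ]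
    {f : X → ℝ} (hf : Continuous f) : (μ.withDensity fun x => ENNReal.ofReal (f x)).Regular := by
  let g : C(X, ℝ) := ⟨f, hf⟩
  have : (ENNReal.ofReal ‖g‖ • μ).Regular := Measure.Regular.smul ENNReal.ofReal_ne_top
  have : IsFiniteMeasure (ENNReal.ofReal ‖g‖ • μ) := μ.smul_finite ENNReal.ofReal_ne_top
  refine regular_of_le (μ := ENNReal.ofReal ‖g‖ • μ) ?_
  rw [← withDensity_const]
  exact withDensity_mono (.of_forall fun x => ENNReal.ofReal_le_ofReal
    ((le_abs_self _).trans (g.norm_coe_le_norm x)))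

variable {A C : Type*} [CommRing A] [Algebra ℝ A] [CommRing C] [Algebra ℝ C] {L : A →ₗ[ℝ] ℝ}
  {M : Submonoid A}

theorem FractionModel.measure_eq_withDensity (D : FractionModel L M C) {y : C} {m : A}
    (hy : D.IsFrac y m 1) {μ ρ : Measure (PosCharacter D.P)} [μ.Regular] [ρ.Regular]
    [IsFiniteMeasure μ] [IsFiniteMeasure ρ] (hμ : ∀ b, D.Λ 1 b = ∫ φ, φ.1 b ∂μ)
    (hρ : ∀ b, D.Λ m b = ∫ φ, φ.1 b ∂ρ) :
    μ = ρ.withDensity fun φ => ENNReal.ofReal (φ.1 y ^ 2) := by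
  have := compactSpace_posCharacter D.cone
  have hc : Continuous fun φ : PosCharacter D.P => φ.1 y := (evalPosCharacter D.P y).continuous
  have h1 : (ρ.withDensity fun φ => ENNReal.ofReal (φ.1 y ^ 2)).Regular :=
    regular_withDensity_ofReal ρ (hc.pow 2)
  have h2 : IsFiniteMeasure (ρ.withDensity fun φ => ENNReal.ofReal (φ.1 y ^ 2)) :=
    ⟨isCompact_univ.measure_lt_top⟩
  refine measure_eq_of_separating (evalPosCharacter D.P).range ?_ _ _ ?_
  · intro φ ψ hne
    obtain ⟨b, hb⟩ : ∃ b, φ.1 b ≠ ψ.1 b := by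
      by_contra hcon
      push Not at hcon
      exact hne (Subtype.ext (AlgHom.ext hcon))
    exact ⟨_, ⟨_, ⟨b, rfl⟩, rfl⟩, hb⟩
  · rintro _ ⟨b, rfl⟩
    change ∫ φ : PosCharacter D.P, φ.1 b ∂μ = ∫ φ : PosCharacter D.P, φ.1 b ∂_
    rw [← hμ, ← D.apply_frac_sq hy, hρ, integral_withDensity_eq_integral_toReal_smul
      (by fun_prop) (.of_forall fun _ => ENNReal.ofReal_lt_top)]
    refine integral_congr_ae (.of_forall fun φ => ?_)
    simp only [map_mul, smul_eq_mul]
    rw [ENNReal.toReal_ofReal (sq_nonneg _)]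
    ring

theorem FractionModel.div_eq_div (D : FractionModel L M C) {φ : C →ₐ[ℝ] ℝ} {a m m' : A}
    {x y x' y' : C} (hm : m ∈ M) (hm' : m' ∈ M) (hx : D.IsFrac x m a) (hy : D.IsFrac y m 1)
    (hx' : D.IsFrac x' m' a) (hy' : D.IsFrac y' m' 1) (h : φ y ≠ 0) (h' : φ y' ≠ 0) :
    φ x / φ y = φ x' / φ y' := by
  rw [div_eq_div_iff h h', ← map_mul, ← map_mul]
  congr 1
  exact D.isFrac_unique (mul_mem hm hm') (mul_mem hm' hm) (D.isFrac_mul hx hy')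
    (D.isFrac_mul hx' hy) (by ring)

theorem FractionModel.exists_frac (D : FractionModel L M C) (V : Submodule ℝ A)
    (hgen : Algebra.adjoin ℝ (V : Set A) = ⊤) {s t : V → C}
    (hV : ∀ v : V, 1 + (v : A) * v ∈ M) (hs : ∀ v : V, D.IsFrac (s v) (1 + v * v) 1)
    (ht : ∀ v : V, D.IsFrac (t v) (1 + v * v) v) (a : A) :
    ∃ m ∈ M, ∃ x y, D.IsFrac x m a ∧ D.IsFrac y m 1 ∧
      ∀ φ : Character C, (∀ v, φ (s v) ≠ 0) → φ y ≠ 0 := by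
  have ha : a ∈ Algebra.adjoin ℝ (V : Set A) := by rw [hgen]; trivial
  induction ha using Algebra.adjoin_induction with
  | mem v hv => exact ⟨_, hV ⟨v, hv⟩, _, _, ht ⟨v, hv⟩, hs ⟨v, hv⟩, fun φ h => h _⟩
  | algebraMap r =>
    refine ⟨1, one_mem _, _, 1, D.isFrac_algebraMap r, ?_, fun φ _ => ?_⟩
    · simpa using D.isFrac_algebraMap 1
    · simp
  | add a b _ _ iha ihb =>
    obtain ⟨m, hm, x, y, hx, hy, h⟩ := iha
    obtain ⟨m', hm', x', y', hx', hy', h'⟩ := ihb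
    refine ⟨m * m', mul_mem hm hm', x * y' + y * x', y * y', ?_, ?_, fun φ hφ => ?_⟩
    · simpa using D.isFrac_add (D.isFrac_mul hx hy') (D.isFrac_mul hy hx')
    · simpa using D.isFrac_mul hy hy'
    · rw [map_mul]
      exact mul_ne_zero (h φ hφ) (h' φ hφ)
  | mul a b _ _ iha ihb =>
    obtain ⟨m, hm, x, y, hx, hy, h⟩ := iha
    obtain ⟨m', hm', x', y', hx', hy', h'⟩ := ihb
    refine ⟨m * m', mul_mem hm hm', x * x', y * y', ?_, ?_, fun φ hφ => ?_⟩
    · exact D.isFrac_mul hx hx'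
    · simpa using D.isFrac_mul hy hy'
    · rw [map_mul]
      exact mul_ne_zero (h φ hφ) (h' φ hφ)

/-- A stochastic process indexed by `A` on a probability space `Y`, whose paths are characters
wherever all `σ v` are nonzero. -/
structure RandomCharacter (L : A →ₗ[ℝ] ℝ) (V : Submodule ℝ A) (Y : Type*) [TopologicalSpace Y]
    [MeasurableSpace Y] (μ : Measure Y) where
  σ : V → C(Y, ℝ)
  X : A → Y → ℝ
  exists_character : ∀ y, (∀ v, σ v y ≠ 0) → ∃ α : Character A, ∀ a, α a = X a y
  continuousOn : ∀ a, ContinuousOn (X a) {y | ∀ v, σ v y ≠ 0}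
  σ_mul : ∀ y, (∀ v, σ v y ≠ 0) → ∀ v : V, σ v y * (1 + X v y ^ 2) = 1
  σ_mul_ae : ∀ v : V, ∀ᵐ y ∂μ, σ v y * (1 + X v y ^ 2) = 1
  measurable : ∀ a, Measurable (X a)
  integral_eq : ∀ a, ∫ y, X a y ∂μ = L a
  lintegral_le : ∀ a, ∫⁻ y, ENNReal.ofReal (X a y ^ 2) ∂μ ≤ ENNReal.ofReal (L (a * a))
  ae_add : ∀ a b, ∀ᵐ y ∂μ, X (a + b) y = X a y + X b y
  ae_smul : ∀ (r : ℝ) a, ∀ᵐ y ∂μ, X (r • a) y = r * X a y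
  nonneg : ∀ y, (∀ v, σ v y ≠ 0) → ∀ a, (∀ u, 0 ≤ L (a * (u * u))) → 0 ≤ X a y

end RandomCharacter

section RandomCharacterExistence

variable {A C : Type*} [CommRing A] [Algebra ℝ A] [CommRing C] [Algebra ℝ C] {L : A →ₗ[ℝ] ℝ}
  {M : Submonoid A}

theorem FractionModel.exists_randomCharacter (D : FractionModel L M C) (V : Submodule ℝ A)
    (hgen : Algebra.adjoin ℝ (V : Set A) = ⊤) (hL1 : L 1 = 1)
    (hV : ∀ v : V, 1 + (v : A) * v ∈ M) :
    ∃ μ : Measure (PosCharacter D.P), μ.Regular ∧ IsProbabilityMeasure μ ∧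
      Nonempty (RandomCharacter L V (PosCharacter D.P) μ) := by
  have := compactSpace_posCharacter D.cone
  choose s t hs ht using fun v : V => D.isFrac_one_add_sq v (hV v)
  choose m hm x y hx hy hnd using D.exists_frac V hgen hV hs ht
  have hone : D.IsFrac 1 1 1 := by simpa using D.isFrac_algebraMap 1
  have hadd : ∀ (φ : Character C) a b, φ (y a) ≠ 0 → φ (y b) ≠ 0 → φ (y (a + b)) ≠ 0 →
      φ (x (a + b)) / φ (y (a + b)) = φ (x a) / φ (y a) + φ (x b) / φ (y b) := by
    intro φ a b h1 h2 h3
    have e1 : D.IsFrac (x a * y b + y a * x b) (m a * m b) (a + b) := by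
      simpa using D.isFrac_add (D.isFrac_mul (hx a) (hy b)) (D.isFrac_mul (hy a) (hx b))
    have e2 : D.IsFrac (y a * y b) (m a * m b) 1 := by simpa using D.isFrac_mul (hy a) (hy b)
    rw [D.div_eq_div (hm _) (mul_mem (hm a) (hm b)) (hx _) (hy _) e1 e2 h3
      (by rw [map_mul]; exact mul_ne_zero h1 h2), map_add, map_mul, map_mul, map_mul]
    field_simp
  have hmul : ∀ (φ : Character C) a b, φ (y a) ≠ 0 → φ (y b) ≠ 0 → φ (y (a * b)) ≠ 0 →
      φ (x (a * b)) / φ (y (a * b)) = φ (x a) / φ (y a) * (φ (x b) / φ (y b)) := by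
    intro φ a b h1 h2 h3
    have e2 : D.IsFrac (y a * y b) (m a * m b) 1 := by simpa using D.isFrac_mul (hy a) (hy b)
    rw [D.div_eq_div (hm _) (mul_mem (hm a) (hm b)) (hx _) (hy _) (D.isFrac_mul (hx a) (hx b)) e2
      h3 (by rw [map_mul]; exact mul_ne_zero h1 h2), map_mul, map_mul]
    field_simp
  have halg : ∀ (φ : Character C) r, φ (y (algebraMap ℝ A r)) ≠ 0 →
      φ (x (algebraMap ℝ A r)) / φ (y (algebraMap ℝ A r)) = r := by
    intro φ r h
    rw [D.div_eq_div (hm _) (one_mem M) (hx _) (hy _) (D.isFrac_algebraMap r) hone h (by simp)]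
    simp
  have hcont : ∀ b : C, Continuous fun φ : PosCharacter D.P => φ.1 b :=
    fun b => (evalPosCharacter D.P b).continuous
  choose μ hreg hfin hμ using fun c => exists_measure_posCharacter D.cone (D.Λ c) (D.nonneg c)
  have hdens : ∀ {w n}, D.IsFrac w n 1 → μ 1 = (μ n).withDensity
      fun φ => ENNReal.ofReal (φ.1 w ^ 2) :=
    fun h => D.measure_eq_withDensity h (hμ 1) (hμ _)
  have hnz : ∀ {w n}, D.IsFrac w n 1 → ∀ᵐ φ ∂μ 1, φ.1 w ≠ 0 := by
    intro w n h
    have hmeas : MeasurableSet {φ : PosCharacter D.P | φ.1 w = 0} :=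
      (isClosed_eq (hcont w) continuous_const).measurableSet
    rw [ae_iff]
    simp only [not_not]
    rw [hdens h, withDensity_apply _ hmeas]
    refine (setLIntegral_congr_fun hmeas (g := fun _ => 0) fun φ hφ => ?_).trans (by simp)
    have : φ.1 w = 0 := hφ
    simp [this]
  have hprob : IsProbabilityMeasure (μ 1) := by
    have h := hμ 1 1
    rw [D.apply_one, mul_one, hL1] at h
    simp only [map_one, integral_const, smul_eq_mul, mul_one] at h
    exact ⟨(ENNReal.toReal_eq_one_iff _).mp h.symm⟩
  have hσ : ∀ (φ : Character C) (v : V), φ (s v) ≠ 0 → φ (y v) ≠ 0 →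
      φ (s v) * (1 + (φ (x v) / φ (y v)) ^ 2) = 1 := by
    intro φ v h1 h2
    have e : D.IsFrac (s v * s v + t v * t v) ((1 + v * v) * (1 + v * v)) (1 * 1 + v * v) :=
      D.isFrac_add (D.isFrac_mul (hs v) (hs v)) (D.isFrac_mul (ht v) (ht v))
    have e' := congrArg φ (D.isFrac_unique (hV v) (mul_mem (hV v) (hV v)) (hs v) e (by ring))
    rw [map_add, map_mul, map_mul] at e'
    rw [D.div_eq_div (hm v) (hV v) (hx v) (hy v) (ht v) (hs v) h2 h1]
    field_simp
    linarith
  refine ⟨μ 1, hreg 1, hprob, ⟨?_⟩⟩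
  exact {
    σ := fun v => evalPosCharacter D.P (s v)
    X := fun a φ => φ.1 (x a) / φ.1 (y a)
    exists_character := fun φ hφ => by
      have h : ∀ a, φ.1 (y a) ≠ 0 := fun a => hnd a φ.1 hφ
      exact ⟨{
        toFun := fun a => φ.1 (x a) / φ.1 (y a)
        map_one' := by simpa using halg φ.1 1 (h _)
        map_mul' := fun a b => hmul φ.1 a b (h _) (h _) (h _)
        map_zero' := by simpa using halg φ.1 0 (h _)
        map_add' := fun a b => hadd φ.1 a b (h _) (h _) (h _)
        commutes' := fun r => halg φ.1 r (h _) }, fun a => rfl⟩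
    continuousOn := fun a => (hcont _).continuousOn.div (hcont _).continuousOn
      fun φ hφ => hnd a φ.1 hφ
    σ_mul := fun φ hφ v => hσ φ.1 v (hφ v) (hnd v φ.1 hφ)
    σ_mul_ae := fun v => by
      filter_upwards [hnz (hs v), hnz (hy v)] with φ h1 h2 using hσ φ.1 v h1 h2
    measurable := fun a => (hcont _).measurable.div (hcont _).measurable
    integral_eq := fun a => by
      have hc := hcont (y a)
      rw [hdens (hy a), integral_withDensity_eq_integral_toReal_smul
        (by fun_prop) (.of_forall fun _ => ENNReal.ofReal_lt_top), ← D.apply_frac_mul (hx a) (hy a),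
        hμ]
      refine integral_congr_ae (.of_forall fun φ => ?_)
      simp only [map_mul, smul_eq_mul]
      rw [ENNReal.toReal_ofReal (sq_nonneg _)]
      by_cases h : φ.1 (y a) = 0
      · simp [h]
      · field_simp
    lintegral_le := fun a => by
      have hc := hcont (y a)
      have hc' := hcont (x a)
      rw [hdens (hy a), lintegral_withDensity_eq_lintegral_mul _ (by fun_prop) (by fun_prop),
        ← D.apply_one, ← one_mul (1 : C)]
      have h := D.apply_frac_sq (hx a) 1
      rw [mul_one, ← h, hμ, ofReal_integral_eq_lintegral_ofReal]
      · refine lintegral_mono fun φ => ?_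
        simp only [Pi.mul_apply, one_mul, map_mul]
        rw [← ENNReal.ofReal_mul (sq_nonneg _)]
        refine ENNReal.ofReal_le_ofReal ?_
        by_cases h : φ.1 (y a) = 0
        · simp only [h]
          nlinarith [mul_self_nonneg (φ.1 (x a))]
        · field_simp
          exact le_refl _
      · exact (evalPosCharacter D.P (1 * (x a * x a))).continuous.integrable_of_hasCompactSupport
          (HasCompactSupport.of_compactSpace _)
      · refine .of_forall fun φ => ?_
        simp only [one_mul, map_mul]
        exact mul_self_nonneg _
    ae_add := fun a b => by
      filter_upwards [hnz (hy a), hnz (hy b), hnz (hy (a + b))] with φ h1 h2 h3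
        using hadd φ.1 a b h1 h2 h3
    ae_smul := fun r a => by
      filter_upwards [hnz (hy a), hnz (hy (algebraMap ℝ A r)), hnz (hy (r • a))] with φ h1 h2 h3
      rw [Algebra.smul_def] at h3 ⊢
      rw [hmul φ.1 _ _ h2 h1 h3, halg φ.1 r h2]
    nonneg := fun φ hφ a ha => by
      have h1 : x a * y a ∈ D.P := D.isFrac_pos (mul_mem (hm a) (hm a))
        (D.isFrac_mul (hx a) (hy a)) fun q => by
          have := ha (m a * q)
          rwa [show a * 1 * (m a * m a) * (q * q) = a * (m a * q * (m a * q)) by ring]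
      have h2 := φ.2 _ h1
      rw [map_mul] at h2
      have h3 := hnd a φ.1 hφ
      rw [← mul_div_mul_right _ _ h3]
      exact div_nonneg h2 (mul_self_nonneg _) }

end RandomCharacterExistence

section Orthonormal

variable {V : Type*} [AddCommGroup V] [Module ℝ V]

theorem HilbSeminorm.bilin_eq_zero (q : HilbSeminorm V) {z : V} (hz : q.bilin z z = 0) (w : V) :
    q.bilin z w = 0 := by
  have h : ∀ r : ℝ, 0 ≤ q.bilin w w + 2 * r * q.bilin z w := by
    intro r
    have := q.nonneg (w + r • z)
    simp only [map_add, LinearMap.add_apply, map_smul, LinearMap.smul_apply, smul_eq_mul, hz,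
      q.symm w z] at this
    linarith
  by_contra hne
  have := h (-(q.bilin w w + 1) / (2 * q.bilin z w))
  field_simp at this
  linarith

open scoped Classical in
theorem HilbSeminorm.exists_isONS (q : HilbSeminorm V) (F : Finset V) :
    ∃ E : Finset V, q.IsONS E ∧ ∀ v ∈ F,
      q.bilin (v - ∑ e ∈ E, q.bilin v e • e) (v - ∑ e ∈ E, q.bilin v e • e) = 0 := by
  induction F using Finset.induction_on with
  | empty => exact ⟨∅, ⟨by simp, by simp⟩, by simp⟩
  | insert v F _ ih =>
    obtain ⟨E, hE, hF⟩ := ih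
    by_cases h0 : q.bilin (v - ∑ e ∈ E, q.bilin v e • e) (v - ∑ e ∈ E, q.bilin v e • e) = 0
    · refine ⟨E, hE, fun u hu => ?_⟩
      rcases Finset.mem_insert.mp hu with rfl | hu
      exacts [h0, hF u hu]
    have horth : ∀ u, ∀ f ∈ E, q.bilin (u - ∑ e ∈ E, q.bilin u e • e) f = 0 := by
      intro u f hf
      simp only [map_sub, map_sum, map_smul, LinearMap.sub_apply, LinearMap.sum_apply,
        LinearMap.smul_apply, smul_eq_mul]
      rw [Finset.sum_eq_single f (fun e he hne => by rw [hE.2 e he f hf hne, mul_zero])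
        (fun h => absurd hf h), hE.1 f hf, mul_one, sub_self]
    set w := v - ∑ e ∈ E, q.bilin v e • e with hw
    have hpos : 0 < q.bilin w w := (q.nonneg w).lt_of_ne' h0
    set c := √(q.bilin w w) with hcdef
    have hc : 0 < c := Real.sqrt_pos.mpr hpos
    have hcc : q.bilin w w = c * c := (Real.mul_self_sqrt hpos.le).symm
    have hew : ∀ f ∈ E, q.bilin (c⁻¹ • w) f = 0 := by
      intro f hf
      rw [map_smul, LinearMap.smul_apply, horth v f hf, smul_zero]
    have hee : q.bilin (c⁻¹ • w) (c⁻¹ • w) = 1 := by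
      simp only [map_smul, LinearMap.smul_apply, smul_eq_mul]
      rw [hcc]
      field_simp
    have hnot : c⁻¹ • w ∉ E := by
      intro hmem
      have := hew _ hmem
      rw [hee] at this
      exact one_ne_zero this
    have hue : ∀ u, q.bilin u (c⁻¹ • w) =
        q.bilin (u - ∑ e ∈ E, q.bilin u e • e) (c⁻¹ • w) := by
      intro u
      simp only [map_sub, map_sum, LinearMap.sub_apply, LinearMap.sum_apply, map_smul,
        LinearMap.smul_apply, smul_eq_mul]
      congr 1
      rw [eq_sub_iff_add_eq, add_eq_left]
      refine Finset.sum_eq_zero fun f hf => ?_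
      have := horth v f hf
      rw [← hw] at this
      rw [q.symm f w, this, mul_zero]
    refine ⟨insert (c⁻¹ • w) E, ⟨?_, ?_⟩, fun u hu => ?_⟩
    · intro e he
      rcases Finset.mem_insert.mp he with rfl | he
      exacts [hee, hE.1 e he]
    · intro e he f hf hne
      rcases Finset.mem_insert.mp he with rfl | he <;> rcases Finset.mem_insert.mp hf with rfl | hf
      · exact absurd rfl hne
      · exact hew f hf
      · rw [q.symm]; exact hew e he
      · exact hE.2 e he f hf hne
    · rw [Finset.sum_insert hnot, hue u]
      rcases Finset.mem_insert.mp hu with rfl | hu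
      · rw [← hw, map_smul, smul_eq_mul, hcc, show c⁻¹ * (c * c) = c by field_simp, smul_smul,
          mul_inv_cancel₀ hc.ne', one_smul, show u - (w + ∑ e ∈ E, q.bilin u e • e) = 0 by
            rw [hw]; abel]
        simp
      · rw [q.bilin_eq_zero (hF u hu), zero_smul, zero_add]
        exact hF u hu

theorem HilbSeminorm.sum_sq_le (q : HilbSeminorm V) {E : Finset V} (hE : q.IsONS E) (v : V) :
    ∑ e ∈ E, q.bilin v e ^ 2 ≤ q.bilin v v := by
  have h := q.nonneg (v - ∑ e ∈ E, q.bilin v e • e)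
  have h2 : ∀ f ∈ E, q.bilin (∑ e ∈ E, q.bilin v e • e) f = q.bilin v f := by
    intro f hf
    simp only [map_sum, map_smul, LinearMap.sum_apply, LinearMap.smul_apply, smul_eq_mul]
    rw [Finset.sum_eq_single f (fun e he hne => by rw [hE.2 e he f hf hne, mul_zero])
      (fun h => absurd hf h), hE.1 f hf, mul_one]
  have h3 : q.bilin v (∑ e ∈ E, q.bilin v e • e) = ∑ e ∈ E, q.bilin v e ^ 2 := by
    simp [map_sum, pow_two]
  have h4 : q.bilin (∑ e ∈ E, q.bilin v e • e) (∑ e ∈ E, q.bilin v e • e) =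
      ∑ e ∈ E, q.bilin v e ^ 2 := by
    rw [map_sum]
    refine Finset.sum_congr rfl fun f hf => ?_
    rw [map_smul, h2 f hf, smul_eq_mul, pow_two]
  rw [map_sub, map_sub, LinearMap.sub_apply, LinearMap.sub_apply, h3, h4,
    q.symm (∑ e ∈ E, q.bilin v e • e) v, h3] at h
  linarith

theorem HilbSeminorm.sum_le_trace {p q : HilbSeminorm V} (h : p.trace q < ⊤) {E : Finset V}
    (hE : q.IsONS E) : ∑ e ∈ E, p.bilin e e ≤ (p.trace q).toReal := by
  rw [← ENNReal.ofReal_le_iff_le_toReal h.ne]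
  unfold trace at h ⊢
  split_ifs at h ⊢
  · exact le_iSup₂ (f := fun (E : Finset V) (_ : q.IsONS E) =>
      ENNReal.ofReal (∑ e ∈ E, p.bilin e e)) E hE
  · exact le_top

theorem HilbSeminorm.ker_le_of_trace {p q : HilbSeminorm V} (h : p.trace q < ⊤) {v : V}
    (hv : q.bilin v v = 0) : p.bilin v v = 0 := by
  unfold trace at h
  split_ifs at h with hker
  · exact hker v hv
  · exact absurd rfl h.ne

end Orthonormal

section Tightness

variable {A : Type*} [CommRing A] [Algebra ℝ A] {L : A →ₗ[ℝ] ℝ} {V : Submodule ℝ A} {Y : Type*}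
  [TopologicalSpace Y] [MeasurableSpace Y] {μ : Measure Y}

namespace RandomCharacter

theorem ae_sum_smul (R : RandomCharacter L V Y μ) (E : Finset V) (c : V → ℝ) :
    ∀ᵐ y ∂μ, R.X ((∑ e ∈ E, c e • e : V) : A) y = ∑ e ∈ E, c e * R.X e y := by
  classical
  induction E using Finset.induction_on with
  | empty =>
    filter_upwards [R.ae_smul 0 0] with y hy
    simpa using hy
  | insert e E he ih =>
    filter_upwards [ih, R.ae_smul (c e) e, R.ae_add (c e • e) (∑ e ∈ E, c e • e : V)]
      with y h1 h2 h3
    rw [Finset.sum_insert he, Finset.sum_insert he, ← h1, ← h2, ← h3]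
    rfl

theorem ae_eq_zero (R : RandomCharacter L V Y μ) {a : A} (ha : L (a * a) = 0) :
    ∀ᵐ y ∂μ, R.X a y = 0 := by
  have h := R.lintegral_le a
  rw [ha, ENNReal.ofReal_zero, nonpos_iff_eq_zero,
    lintegral_eq_zero_iff ((R.measurable a).pow_const 2).ennreal_ofReal] at h
  filter_upwards [h] with y hy
  have : R.X a y ^ 2 ≤ 0 := ENNReal.ofReal_eq_zero.mp hy
  exact pow_eq_zero_iff two_ne_zero |>.mp (le_antisymm this (sq_nonneg _))

/-- The points at which the process is bounded by `N q`. -/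
def level (R : RandomCharacter L V Y μ) (q : HilbSeminorm V) (N : ℕ) : Set Y :=
  {y | ∀ v, 1 ≤ (1 + (N : ℝ) ^ 2 * q.bilin v v) * R.σ v y}

theorem isClosed_level (R : RandomCharacter L V Y μ) (q : HilbSeminorm V) (N : ℕ) :
    IsClosed (R.level q N) := by
  have : R.level q N = ⋂ v, {y | 1 ≤ (1 + (N : ℝ) ^ 2 * q.bilin v v) * R.σ v y} := by
    ext y
    simp [level]
  rw [this]
  exact isClosed_iInter fun v => isClosed_le (by fun_prop) (by fun_prop)

theorem ne_zero_of_mem_level (R : RandomCharacter L V Y μ) {q : HilbSeminorm V} {N : ℕ} {y : Y}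
    (hy : y ∈ R.level q N) (v : V) : R.σ v y ≠ 0 := by
  intro h
  have := hy v
  rw [h, mul_zero] at this
  linarith

theorem sq_le_of_mem_level (R : RandomCharacter L V Y μ) {q : HilbSeminorm V} {N : ℕ} {y : Y}
    (hy : y ∈ R.level q N) (v : V) : R.X v y ^ 2 ≤ (N : ℝ) ^ 2 * q.bilin v v := by
  have h := R.σ_mul y (R.ne_zero_of_mem_level hy) v
  have h1 := hy v
  have h2 : 0 < R.σ v y := by
    by_contra hcon
    push Not at hcon
    nlinarith [sq_nonneg (R.X v y)]
  have h3 : (1 + R.X v y ^ 2) * R.σ v y ≤ (1 + (N : ℝ) ^ 2 * q.bilin v v) * R.σ v y := by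
    linarith
  linarith [le_of_mul_le_mul_right h3 h2]

theorem monotone_level (R : RandomCharacter L V Y μ) (q : HilbSeminorm V) :
    Monotone (R.level q) := by
  intro N N' h y hy v
  have h1 := hy v
  have hq := q.nonneg v
  have h2 : 0 ≤ R.σ v y := by
    by_contra hcon
    push Not at hcon
    have : 0 ≤ (N : ℝ) ^ 2 * q.bilin v v := by positivity
    nlinarith
  refine h1.trans ?_
  have : (N : ℝ) ≤ N' := by exact_mod_cast h
  gcongr

theorem ae_sq_le (R : RandomCharacter L V Y μ) {hL : ∀ a : A, 0 ≤ L (a * a)} {q : HilbSeminorm V}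
    (hc : ((sLSeminorm L hL).comp V.subtype).trace q < ⊤) {E : Finset V} (hE : q.IsONS E) {v : V}
    (hv : q.bilin (v - ∑ e ∈ E, q.bilin v e • e) (v - ∑ e ∈ E, q.bilin v e • e) = 0) :
    ∀ᵐ y ∂μ, R.X v y ^ 2 ≤ q.bilin v v * ∑ e ∈ E, R.X e y ^ 2 := by
  have h0 : L (((v - ∑ e ∈ E, q.bilin v e • e : V) : A) * (v - ∑ e ∈ E, q.bilin v e • e : V)) = 0 :=
    HilbSeminorm.ker_le_of_trace hc hv
  filter_upwards [R.ae_eq_zero h0, R.ae_sum_smul E fun e => q.bilin v e,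
    R.ae_add (v - ∑ e ∈ E, q.bilin v e • e : V) (∑ e ∈ E, q.bilin v e • e : V)] with y h1 h2 h3
  rw [← Submodule.coe_add, sub_add_cancel, h1, h2, zero_add] at h3
  rw [h3]
  refine (Finset.sum_mul_sq_le_sq_mul_sq E _ _).trans ?_
  exact mul_le_mul_of_nonneg_right (q.sum_sq_le hE v) (Finset.sum_nonneg fun _ _ => sq_nonneg _)

theorem measure_finite_compl_level_le (R : RandomCharacter L V Y μ)
    {hL : ∀ a : A, 0 ≤ L (a * a)} {q : HilbSeminorm V}
    (hc : ((sLSeminorm L hL).comp V.subtype).trace q < ⊤) (F : Finset V) {N : ℕ} (hN : N ≠ 0) :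
    μ (⋃ v ∈ F, {y | (1 + (N : ℝ) ^ 2 * q.bilin v v) * R.σ v y < 1}) ≤
      ((sLSeminorm L hL).comp V.subtype).trace q / (N : ℝ≥0∞) ^ 2 := by
  obtain ⟨E, hE, hF⟩ := q.exists_isONS F
  have hae : ∀ᵐ y ∂μ, y ∈ (⋃ v ∈ F, {y | (1 + (N : ℝ) ^ 2 * q.bilin v v) * R.σ v y < 1}) →
      y ∈ {y | (N : ℝ≥0∞) ^ 2 ≤ ENNReal.ofReal (∑ e ∈ E, R.X e y ^ 2)} := by
    have : ∀ v ∈ F, ∀ᵐ y ∂μ, R.X v y ^ 2 ≤ q.bilin v v * ∑ e ∈ E, R.X e y ^ 2 :=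
      fun v hv => R.ae_sq_le hc hE (hF v hv)
    have h1 := (Filter.eventually_all_finset F).mpr this
    have h2 := (Filter.eventually_all_finset F).mpr fun v _ => R.σ_mul_ae v
    filter_upwards [h1, h2] with y h1 h2 hy
    simp only [Set.mem_iUnion, exists_prop] at hy
    obtain ⟨v, hv, hy⟩ := hy
    have hy : (1 + (N : ℝ) ^ 2 * q.bilin v v) * R.σ v y < 1 := hy
    have e1 := h1 v hv
    have e2 := h2 v hv
    have hq := q.nonneg v
    have hσ : 0 < R.σ v y := by
      by_contra hcon
      push Not at hcon
      nlinarith [sq_nonneg (R.X v y)]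
    have e3 : (N : ℝ) ^ 2 * q.bilin v v < R.X v y ^ 2 := by
      rw [← e2, mul_comm] at hy
      linarith [lt_of_mul_lt_mul_left hy hσ.le]
    have e4 : (N : ℝ) ^ 2 ≤ ∑ e ∈ E, R.X e y ^ 2 := by
      by_contra hcon
      push Not at hcon
      nlinarith [mul_le_mul_of_nonneg_left hcon.le hq]
    change (N : ℝ≥0∞) ^ 2 ≤ _
    rw [← ENNReal.ofReal_natCast, ← ENNReal.ofReal_pow (by positivity)]
    exact ENNReal.ofReal_le_ofReal e4
  have hN2 : (N : ℝ≥0∞) ^ 2 ≠ 0 := by positivity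
  have hN3 : (N : ℝ≥0∞) ^ 2 ≠ ⊤ := ENNReal.pow_ne_top (ENNReal.natCast_ne_top N)
  have hm : ∀ e : V, Measurable (R.X e) := fun e => R.measurable e
  refine (measure_mono_ae hae).trans ((meas_ge_le_lintegral_div (by fun_prop) hN2 hN3).trans ?_)
  gcongr
  have e1 : ∀ y, ENNReal.ofReal (∑ e ∈ E, R.X e y ^ 2) =
      ∑ e ∈ E, ENNReal.ofReal (R.X (e : A) y ^ 2) :=
    fun y => ENNReal.ofReal_sum_of_nonneg fun _ _ => sq_nonneg _
  simp_rw [e1]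
  rw [lintegral_finsetSum _ fun e _ => by fun_prop]
  refine (Finset.sum_le_sum fun (e : V) _ => R.lintegral_le e).trans ?_
  rw [← ENNReal.ofReal_sum_of_nonneg fun e _ => hL _]
  exact ENNReal.ofReal_le_of_le_toReal (HilbSeminorm.sum_le_trace hc hE)

theorem measure_compl_level_le [μ.InnerRegularCompactLTTop] [IsFiniteMeasure μ]
    [OpensMeasurableSpace Y] (R : RandomCharacter L V Y μ)
    {hL : ∀ a : A, 0 ≤ L (a * a)} {q : HilbSeminorm V}
    (hc : ((sLSeminorm L hL).comp V.subtype).trace q < ⊤) {N : ℕ} (hN : N ≠ 0) :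
    μ (R.level q N)ᶜ ≤ ((sLSeminorm L hL).comp V.subtype).trace q / (N : ℝ≥0∞) ^ 2 := by
  by_contra hcon
  push Not at hcon
  obtain ⟨K, hK, hKc, hlt⟩ := (R.isClosed_level q N).isOpen_compl.measurableSet
    |>.exists_lt_isCompact_of_ne_top (measure_ne_top _ _) hcon
  obtain ⟨F, hF⟩ := hKc.elim_finite_subcover
    (fun v : V => {y | (1 + (N : ℝ) ^ 2 * q.bilin v v) * R.σ v y < 1})
    (fun v => isOpen_lt (by fun_prop) (by fun_prop)) fun y hy => by
      have := hK hy
      simp only [level, Set.mem_compl_iff, Set.mem_ofPred_eq, not_forall, not_le] at this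
      obtain ⟨v, hv⟩ := this
      exact Set.mem_iUnion.mpr ⟨v, hv⟩
  exact absurd (hlt.trans_le (measure_mono hF)) (not_lt.mpr
    (R.measure_finite_compl_level_le hc F hN))

theorem measure_compl_iUnion_level [μ.InnerRegularCompactLTTop] [IsFiniteMeasure μ]
    [OpensMeasurableSpace Y] (R : RandomCharacter L V Y μ)
    {hL : ∀ a : A, 0 ≤ L (a * a)} {q : HilbSeminorm V}
    (hc : ((sLSeminorm L hL).comp V.subtype).trace q < ⊤) :
    μ (⋃ N, R.level q N)ᶜ = 0 := by
  set T := ((sLSeminorm L hL).comp V.subtype).trace q with hT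
  have h1 : ∀ N : ℕ, μ (⋃ N, R.level q N)ᶜ ≤ T / ((N + 1 : ℕ) : ℝ≥0∞) := by
    intro N
    refine (measure_mono (Set.compl_subset_compl.mpr
      (Set.subset_iUnion _ (N + 1)))).trans ((R.measure_compl_level_le hc N.succ_ne_zero).trans ?_)
    gcongr
    rw [← Nat.cast_pow]
    exact_mod_cast Nat.le_self_pow two_ne_zero _
  have h2 : Filter.Tendsto (fun N : ℕ => T / ((N + 1 : ℕ) : ℝ≥0∞)) Filter.atTop (nhds 0) := by
    have := ENNReal.Tendsto.const_mul (a := T)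
      (ENNReal.tendsto_inv_nat_nhds_zero.comp (Filter.tendsto_add_atTop_nat 1)) (Or.inr hc.ne)
    simpa [div_eq_mul_inv] using this
  exact le_antisymm (ge_of_tendsto' h2 h1) bot_le

end RandomCharacter

end Tightness

section Existence

theorem Character.continuousOn_iff {A Y : Type*} [CommRing A] [Algebra ℝ A] [TopologicalSpace Y]
    {f : Y → Character A} {s : Set Y} : ContinuousOn f s ↔ ∀ a, ContinuousOn (fun y => f y a) s := by
  rw [(Character.isInducing A).continuousOn_iff, continuousOn_pi]
  rfl

variable {A : Type*} [CommRing A] [Algebra ℝ A] {L : A →ₗ[ℝ] ℝ} {V : Submodule ℝ A} {Y : Type*}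
  [TopologicalSpace Y] [CompactSpace Y] [MeasurableSpace Y] [BorelSpace Y]
  {μ : Measure Y}

theorem RandomCharacter.exists_radonMeasure [μ.Regular] [IsProbabilityMeasure μ]
    (R : RandomCharacter L V Y μ) {Q : Set A} (hQ : IsQuadraticModule Q) (ha : ∀ a ∈ Q, 0 ≤ L a)
    {hL : ∀ a : A, 0 ≤ L (a * a)} {q : HilbSeminorm V} (α₀ : Character A)
    (hc : ((sLSeminorm L hL).comp V.subtype).trace q < ⊤) :
    ∃ ν : Measure (Character A), IsRadonMeasure ν ∧ (∀ a : A, L a = ∫ α : Character A, α a ∂ν) ∧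
      ν {α : Character A | ¬ (α ∈ charNonneg Q ∧ QContOn V q.toFun α)} = 0 := by
  classical
  set G : Set Y := ⋃ N, R.level q N with hG
  have hGm : MeasurableSet G := MeasurableSet.iUnion fun N => (R.isClosed_level q N).measurableSet
  have hG0 : μ Gᶜ = 0 := R.measure_compl_iUnion_level hc
  have hnd : ∀ y ∈ G, ∀ v, R.σ v y ≠ 0 := by
    intro y hy v
    obtain ⟨N, hN⟩ := Set.mem_iUnion.mp hy
    exact R.ne_zero_of_mem_level hN v
  have hex : ∀ y, ∃ α : Character A, if y ∈ G then ∀ a, α a = R.X a y else α = α₀ := by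
    intro y
    by_cases hy : y ∈ G
    · simpa only [if_pos hy] using R.exists_character y (hnd y hy)
    · exact ⟨α₀, by rw [if_neg hy]⟩
  choose ψ hψ using hex
  have hψG : ∀ y ∈ G, ∀ a, ψ y a = R.X a y := fun y hy => by simpa only [if_pos hy] using hψ y
  have hψc : ContinuousOn ψ G := by
    rw [Character.continuousOn_iff]
    intro a
    exact ((R.continuousOn a).mono fun y hy => hnd y hy).congr fun y hy => hψG y hy a
  have hψm : Measurable ψ := by
    have h1 : ContinuousOn ψ Gᶜ := by
      refine (continuousOn_const (c := α₀)).congr fun y hy => ?_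
      have := hψ y
      rwa [if_neg hy] at this
    have := hψc.measurable_piecewise h1 hGm
    rwa [Set.piecewise_same] at this
  have hae : ∀ᵐ y ∂μ, y ∈ G := hG0
  have : IsProbabilityMeasure (μ.map ψ) := Measure.isProbabilityMeasure_map hψm.aemeasurable
  refine ⟨μ.map ψ, ⟨inferInstance, ?_⟩, ?_, ?_⟩
  · intro B hB r hr
    rw [Measure.map_apply hψm hB] at hr
    obtain ⟨N, hN⟩ : ∃ N, r < μ (ψ ⁻¹' B ∩ R.level q N) := by
      rw [← lt_iSup_iff, ← Monotone.measure_iUnion, ← Set.inter_iUnion]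
      · rwa [measure_inter_conull hG0]
      · exact fun i j h => Set.inter_subset_inter_right _ (R.monotone_level q h)
    obtain ⟨K, hK, hKc, hlt⟩ := ((hψm hB).inter (R.isClosed_level q N).measurableSet)
      |>.exists_lt_isCompact_of_ne_top (measure_ne_top _ _) hN
    have hKG : K ⊆ G := fun y hy => Set.mem_iUnion.mpr ⟨N, (hK hy).2⟩
    have hKi : IsCompact (ψ '' K) := hKc.image_of_continuousOn (hψc.mono hKG)
    refine ⟨ψ '' K, ?_, hKi, ?_⟩
    · rintro _ ⟨y, hy, rfl⟩
      exact (hK hy).1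
    · rw [Measure.map_apply hψm hKi.measurableSet]
      exact hlt.trans_le (measure_mono (Set.subset_preimage_image _ _))
  · intro a
    rw [integral_map hψm.aemeasurable (Character.continuous_eval a).aestronglyMeasurable,
      ← R.integral_eq a]
    refine integral_congr_ae ?_
    filter_upwards [hae] with y hy using (hψG y hy a).symm
  · have hGi : MeasurableSet (ψ '' G) := by
      rw [hG, Set.image_iUnion]
      exact MeasurableSet.iUnion fun N => ((R.isClosed_level q N).isCompact.image_of_continuousOn
        (hψc.mono (Set.subset_iUnion _ N))).measurableSet
    have hgood : ∀ y ∈ G, ψ y ∈ charNonneg Q ∧ QContOn V q.toFun (ψ y) := by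
      intro y hy
      constructor
      · intro a haQ
        rw [hψG y hy]
        refine R.nonneg y (hnd y hy) a fun u => ?_
        have := ha _ (hQ.2.2 u a haQ)
        rwa [show u ^ 2 * a = a * (u * u) by ring] at this
      · obtain ⟨N, hN⟩ := Set.mem_iUnion.mp hy
        refine ⟨N + 1, by positivity, fun v => ?_⟩
        rw [hψG y hy]
        refine (Real.abs_le_sqrt (R.sq_le_of_mem_level hN v)).trans ?_
        rw [Real.sqrt_mul (by positivity), Real.sqrt_sq (by positivity)]
        have : 0 ≤ √(q.bilin v v) := Real.sqrt_nonneg _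
        change _ ≤ (N + 1 : ℝ) * √(q.bilin v v)
        linarith
    refine measure_mono_null (t := (ψ '' G)ᶜ) ?_ ?_
    · rintro α hα ⟨y, hy, rfl⟩
      exact hα (hgood y hy)
    · rw [Measure.map_apply hψm hGi.compl]
      exact measure_mono_null (fun y hy hyG => hy ⟨y, hyG, rfl⟩) hG0

end Existence

section Uniqueness

/-- Finite inner regular measures on a space embedded continuously in a compact space coincide if
they agree on a point-separating algebra of continuous functions on the compact space. -/
theorem measure_eq_of_injective_of_separating {X Z : Type*} [TopologicalSpace X] [T2Space X]
    [MeasurableSpace X] [BorelSpace X] [TopologicalSpace Z] [CompactSpace Z] [T2Space Z]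
    {j : X → Z} (hj : Continuous j) (hinj : Function.Injective j) (S : Subalgebra ℝ C(Z, ℝ))
    (hS : S.SeparatesPoints) (μ ν : Measure X) [IsFiniteMeasure μ] [IsFiniteMeasure ν]
    [μ.InnerRegular] [ν.InnerRegular] (h : ∀ f ∈ S, ∫ x, f (j x) ∂μ = ∫ x, f (j x) ∂ν) :
    μ = ν := by
  borelize Z
  have h1 : (μ.map j).InnerRegular := Measure.InnerRegular.map_of_continuous hj
  have h2 : (ν.map j).InnerRegular := Measure.InnerRegular.map_of_continuous hj
  have hmap : μ.map j = ν.map j := measure_eq_of_separating S hS _ _ fun f hf => by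
    rw [integral_map hj.measurable.aemeasurable f.continuous.aestronglyMeasurable,
      integral_map hj.measurable.aemeasurable f.continuous.aestronglyMeasurable]
    exact h f hf
  have hK : ∀ K : Set X, IsCompact K → μ K = ν K := by
    intro K hK
    have hm : MeasurableSet (j '' K) := (hK.image hj).measurableSet
    rw [← Set.preimage_image_eq K hinj, ← Measure.map_apply hj.measurable hm,
      ← Measure.map_apply hj.measurable hm, hmap]
  ext B hB
  rw [hB.measure_eq_iSup_isCompact μ, hB.measure_eq_iSup_isCompact ν]
  exact iSup_congr fun K => iSup_congr fun _ => iSup_congr fun hKc => hK K hKc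

variable {A : Type*} [CommRing A] [Algebra ℝ A]

theorem Character.measurable_eval (a : A) : Measurable fun α : Character A => α a :=
  (Character.continuous_eval a).measurable

variable {L : A →ₗ[ℝ] ℝ} {ν ν' : Measure (Character A)}

theorem isProbabilityMeasure_of_represents (hL1 : L 1 = 1)
    (hν : ∀ a : A, L a = ∫ α : Character A, α a ∂ν) : IsProbabilityMeasure ν := by
  have h := hν 1
  simp only [map_one, integral_const, smul_eq_mul, mul_one, hL1] at h
  exact ⟨(ENNReal.toReal_eq_one_iff _).mp h.symm⟩

theorem integrable_sq_of_represents (hL1 : L 1 = 1) (hL : ∀ a : A, 0 ≤ L (a * a))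
    (hν : ∀ a : A, L a = ∫ α : Character A, α a ∂ν) (a : A) :
    Integrable (fun α : Character A => α (a * a)) ν := by
  have := isProbabilityMeasure_of_represents hL1 hν
  by_contra hcon
  have h0 : L (a * a) = 0 := by rw [hν, integral_undef hcon]
  have h1 : L a = 0 := by
    have := sq_apply_mul_le L hL 1 a
    rw [h0, mul_zero, one_mul] at this
    exact pow_eq_zero_iff two_ne_zero |>.mp (le_antisymm this (sq_nonneg _))
  have h2 : ∀ r : ℝ, Integrable (fun α : Character A => α ((1 + r • a) * (1 + r • a))) ν := by
    intro r
    by_contra hr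
    have h3 : L ((1 + r • a) * (1 + r • a)) = 0 := by rw [hν, integral_undef hr]
    have h4 : (1 + r • a) * (1 + r • a) = 1 + (2 * r) • a + (r ^ 2) • (a * a) := by
      simp only [mul_add, add_mul, smul_mul_smul_comm, mul_smul, one_mul, mul_one, pow_two]
      rw [two_smul]
      abel
    rw [h4, map_add, map_add, map_smul, map_smul, h0, h1, hL1] at h3
    simp at h3
  refine hcon ((((h2 1).add (h2 (-1))).sub (integrable_const 2)).const_mul (1 / 2) |>.congr ?_)
  refine .of_forall fun α => ?_
  simp only [Pi.add_apply, Pi.sub_apply, map_mul, map_add, map_one, map_smul, smul_eq_mul]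
  ring

theorem memLp_of_represents (hL1 : L 1 = 1) (hL : ∀ a : A, 0 ≤ L (a * a))
    (hν : ∀ a : A, L a = ∫ α : Character A, α a ∂ν) (a : A) :
    MemLp (fun α : Character A => α a) 2 ν := by
  rw [memLp_two_iff_integrable_sq (Character.measurable_eval a).aestronglyMeasurable]
  simpa only [pow_two, map_mul] using integrable_sq_of_represents hL1 hL hν a

theorem abs_integral_div_sub_le (hL1 : L 1 = 1) (hL : ∀ a : A, 0 ≤ L (a * a))
    (hν : ∀ a : A, L a = ∫ α : Character A, α a ∂ν) {m u p : A} {B δ : ℝ}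
    (hm : ∀ α : Character A, α m ≠ 0) (hB : ∀ α : Character A, |α u / α m| ≤ B) (hδ : 0 < δ)
    (hp : L ((m * p - 1) * (m * p - 1)) ≤ δ ^ 2) :
    |∫ α : Character A, α u / α m ∂ν - L (u * p)| ≤ B * δ := by
  have := isProbabilityMeasure_of_represents hL1 hν
  have hmeas := fun a : A => Character.measurable_eval a
  have hint : ∀ a : A, Integrable (fun α : Character A => α a) ν := fun a =>
    (memLp_of_represents hL1 hL hν a).integrable one_le_two
  have h1 : Integrable (fun α : Character A => α u / α m) ν :=
    .of_bound ((hmeas u).div (hmeas m)).aestronglyMeasurable B (.of_forall hB)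
  rw [hν, ← integral_sub h1 (hint _), ← Real.norm_eq_abs]
  have hsq := integrable_sq_of_represents hL1 hL hν (m * p - 1)
  have hdom : Integrable (fun α : Character A => B * (δ / 2 + α ((m * p - 1) * (m * p - 1)) *
      (1 / (2 * δ)))) ν := ((integrable_const _).add (hsq.mul_const _)).const_mul B
  refine (norm_integral_le_of_norm_le hdom (.of_forall fun α => ?_)).trans ?_
  · have e : α u / α m - α (u * p) = -(α u / α m * α (m * p - 1)) := by
      have := hm α
      simp only [map_mul, map_sub, map_one]
      field_simp
      ring
    have hB0 : 0 ≤ B := (abs_nonneg _).trans (hB α)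
    rw [e, norm_neg, norm_mul, map_mul, Real.norm_eq_abs, Real.norm_eq_abs]
    refine mul_le_mul (hB α) ?_ (abs_nonneg _) hB0
    have h3 : 0 ≤ (|α (m * p - 1)| - δ) ^ 2 * (1 / (2 * δ)) := by positivity
    have h4 : (|α (m * p - 1)| - δ) ^ 2 * (1 / (2 * δ)) = δ / 2 + α (m * p - 1) * α (m * p - 1) *
        (1 / (2 * δ)) - |α (m * p - 1)| := by
      rw [← abs_mul_abs_self (α (m * p - 1))]
      field_simp
      ring
    linarith
  · obtain ⟨α⟩ : Nonempty (Character A) := nonempty_of_isProbabilityMeasure ν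
    have hB0 : 0 ≤ B := (abs_nonneg _).trans (hB α)
    rw [integral_const_mul, integral_add (integrable_const _) (hsq.mul_const _),
      integral_mul_const, ← hν]
    refine mul_le_mul_of_nonneg_left ?_ hB0
    simp only [integral_const, probReal_univ, smul_eq_mul, one_mul]
    have : L ((m * p - 1) * (m * p - 1)) * (1 / (2 * δ)) ≤ δ ^ 2 * (1 / (2 * δ)) := by gcongr
    have h5 : δ ^ 2 * (1 / (2 * δ)) = δ / 2 := by field_simp
    linarith

theorem integral_div_eq_of_represents (hL1 : L 1 = 1) (hL : ∀ a : A, 0 ≤ L (a * a))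
    (hν : ∀ a : A, L a = ∫ α : Character A, α a ∂ν)
    (hν' : ∀ a : A, L a = ∫ α : Character A, α a ∂ν') {m u : A} {B : ℝ}
    (hmM : m ∈ denominators L hL) (hm : ∀ α : Character A, α m ≠ 0)
    (hB : ∀ α : Character A, |α u / α m| ≤ B) :
    ∫ α : Character A, α u / α m ∂ν = ∫ α : Character A, α u / α m ∂ν' := by
  have := isProbabilityMeasure_of_represents hL1 hν
  obtain ⟨α⟩ : Nonempty (Character A) := nonempty_of_isProbabilityMeasure ν
  have hB0 : 0 ≤ B := (abs_nonneg _).trans (hB α)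
  refine eq_of_abs_sub_le_all fun ε hε => ?_
  set δ := ε / (2 * (B + 1)) with hδ
  have hδ0 : 0 < δ := by positivity
  obtain ⟨p, hp⟩ := hmM 1 1 (δ ^ 2) (by positivity)
  rw [one_mul] at hp
  have e1 := abs_integral_div_sub_le hL1 hL hν hm hB hδ0 hp.le
  have e2 := abs_integral_div_sub_le hL1 hL hν' hm hB hδ0 hp.le
  have e3 : 2 * (B * δ) ≤ ε := by
    have : 2 * ((B + 1) * δ) = ε := by rw [hδ]; field_simp
    nlinarith
  rw [abs_le] at e1 e2 ⊢
  constructor <;> linarith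

/-- The bounded coordinates `1 / (1 + v²)` and `v / (1 + v²)` of a character. -/
noncomputable def boundedCoordinates (V : Submodule ℝ A) (α : Character A) : V ⊕ V → Set.Icc (-1 : ℝ) 1 :=
  Sum.elim
    (fun v => ⟨1 / (1 + α v * α v), by
      rw [Set.mem_Icc, ← abs_le, abs_div, abs_one, abs_of_pos (by nlinarith [mul_self_nonneg (α v)]),
        div_le_one (by nlinarith [mul_self_nonneg (α v)])]
      nlinarith [mul_self_nonneg (α v)]⟩)
    (fun v => ⟨α v / (1 + α v * α v), by
      rw [Set.mem_Icc, ← abs_le, abs_div, abs_of_pos (a := 1 + α v * α v) (by nlinarith [mul_self_nonneg (α v)]),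
        div_le_one (by nlinarith [mul_self_nonneg (α v)])]
      nlinarith [sq_nonneg (|α v| - 1), abs_mul_abs_self (α v)]⟩)

theorem continuous_boundedCoordinates (V : Submodule ℝ A) :
    Continuous (boundedCoordinates V) := by
  have h := fun v : V => Character.continuous_eval (v : A)
  have hne : ∀ (v : V) (α : Character A), 1 + α v * α v ≠ 0 :=
    fun v α => by nlinarith [mul_self_nonneg (α v)]
  refine continuous_pi fun i => ?_
  rcases i with v | v
  · exact (continuous_const.div (continuous_const.add ((h v).mul (h v))) (hne v)).subtype_mk _
  · exact ((h v).div (continuous_const.add ((h v).mul (h v))) (hne v)).subtype_mk _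

theorem injective_boundedCoordinates (V : Submodule ℝ A)
    (hgen : Algebra.adjoin ℝ (V : Set A) = ⊤) : Function.Injective (boundedCoordinates V) := by
  intro α β h
  refine AlgHom.ext_of_adjoin_eq_top hgen fun v hv => ?_
  have h1 : 1 / (1 + α v * α v) = 1 / (1 + β v * β v) :=
    congrArg Subtype.val (congrFun h (Sum.inl ⟨v, hv⟩))
  have h2 : α v / (1 + α v * α v) = β v / (1 + β v * β v) :=
    congrArg Subtype.val (congrFun h (Sum.inr ⟨v, hv⟩))
  have h3 : 1 + β v * β v ≠ 0 := by nlinarith [mul_self_nonneg (β v)]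
  rw [div_eq_mul_one_div, h1, div_eq_mul_one_div (β v)] at h2
  exact mul_right_cancel₀ (one_div_ne_zero h3) h2

theorem representing_measure_unique (V : Submodule ℝ A) (hgen : Algebra.adjoin ℝ (V : Set A) = ⊤)
    (hL1 : L 1 = 1) (hL : ∀ a : A, 0 ≤ L (a * a))
    (hV : ∀ v : V, 1 + (v : A) * v ∈ denominators L hL)
    (hr : IsRadonMeasure ν) (hr' : IsRadonMeasure ν')
    (hν : ∀ a : A, L a = ∫ α : Character A, α a ∂ν)
    (hν' : ∀ a : A, L a = ∫ α : Character A, α a ∂ν') : ν = ν' := by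
  have := isProbabilityMeasure_of_represents hL1 hν
  have := isProbabilityMeasure_of_represents hL1 hν'
  have : ν.InnerRegular := ⟨hr.2⟩
  have : ν'.InnerRegular := ⟨hr'.2⟩
  let coord : V ⊕ V → C(V ⊕ V → Set.Icc (-1 : ℝ) 1, ℝ) := fun i => ⟨fun z => z i, by fun_prop⟩
  have hfrac : ∀ f ∈ Algebra.adjoin ℝ (Set.range coord), ∃ m ∈ denominators L hL, ∃ u,
      ∀ α : Character A, α m ≠ 0 ∧ f (boundedCoordinates V α) = α u / α m := by
    intro f hf
    induction hf using Algebra.adjoin_induction with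
    | mem f hf =>
      obtain ⟨i, rfl⟩ := hf
      rcases i with v | v
      · refine ⟨1 + v * v, hV v, 1, fun α => ⟨?_, ?_⟩⟩
        · rw [map_add, map_mul, map_one]
          nlinarith [mul_self_nonneg (α v)]
        · rw [map_add, map_mul, map_one]
          rfl
      · refine ⟨1 + v * v, hV v, v, fun α => ⟨?_, ?_⟩⟩
        · rw [map_add, map_mul, map_one]
          nlinarith [mul_self_nonneg (α v)]
        · rw [map_add, map_mul, map_one]
          rfl
    | algebraMap r => exact ⟨1, one_mem _, algebraMap ℝ A r, fun α => by simp⟩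
    | add f g _ _ ihf ihg =>
      obtain ⟨m, hm, u, h⟩ := ihf
      obtain ⟨n, hn, w, h'⟩ := ihg
      refine ⟨m * n, mul_mem hm hn, u * n + m * w, fun α => ⟨?_, ?_⟩⟩
      · rw [map_mul]; exact mul_ne_zero (h α).1 (h' α).1
      · rw [ContinuousMap.add_apply, (h α).2, (h' α).2, div_add_div _ _ (h α).1 (h' α).1]
        simp only [map_mul, map_add]
    | mul f g _ _ ihf ihg =>
      obtain ⟨m, hm, u, h⟩ := ihf
      obtain ⟨n, hn, w, h'⟩ := ihg
      refine ⟨m * n, mul_mem hm hn, u * w, fun α => ⟨?_, ?_⟩⟩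
      · rw [map_mul]; exact mul_ne_zero (h α).1 (h' α).1
      · rw [ContinuousMap.mul_apply, (h α).2, (h' α).2, div_mul_div_comm, map_mul, map_mul]
  refine measure_eq_of_injective_of_separating (continuous_boundedCoordinates V)
    (injective_boundedCoordinates V hgen) (Algebra.adjoin ℝ (Set.range coord)) ?_ ν ν' ?_
  · intro z z' hne
    obtain ⟨i, hi⟩ := Function.ne_iff.mp hne
    exact ⟨_, ⟨_, Algebra.subset_adjoin ⟨i, rfl⟩, rfl⟩, fun h => hi (Subtype.ext h)⟩
  · intro f hf
    obtain ⟨m, hm, u, h⟩ := hfrac f hf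
    simp_rw [fun α => (h α).2]
    refine integral_div_eq_of_represents hL1 hL hν hν' hm (fun α => (h α).1) (B := ‖f‖) fun α => ?_
    rw [← (h α).2]
    exact f.norm_coe_le_norm _

end Uniqueness

/-- Corollary `thm-um-generating-subspace`: existence and uniqueness of
a representing measure under positivity, a Carleman-type condition and a trace
condition. -/
theorem statement7 {A : Type*} [CommRing A] [Algebra ℝ A]
    (V : Submodule ℝ A) (hgen : Algebra.adjoin ℝ (V : Set A) = ⊤)
    (L : A →ₗ[ℝ] ℝ) (hL1 : L 1 = 1) (hLsq : ∀ a : A, 0 ≤ L (a * a))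
    (Q : Set A) (hQ : IsQuadraticModule Q)
    (q : HilbSeminorm A)
    (hT : ∃ α : Character A, α ∈ charNonneg Q ∧ QContOn V (q.comp V.subtype).toFun α)
    (ha : ∀ a ∈ Q, 0 ≤ L a)
    (hb : ∀ v : V, ∑' n : ℕ,
      (ENNReal.ofReal ((L ((v : A) ^ (2 * (n + 1)))) ^
        ((1 : ℝ) / (2 * (n + 1) : ℝ))))⁻¹ = ⊤)
    (hc : ((sLSeminorm L hLsq).comp V.subtype).trace (q.comp V.subtype) < ⊤) :
    ∃! ν : Measure (Character A), IsRadonMeasure ν ∧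
      (∀ a : A, L a = ∫ α : Character A, α a ∂ν) ∧
      ν {α : Character A |
        ¬ (α ∈ charNonneg Q ∧ QContOn V (q.comp V.subtype).toFun α)} = 0 := by
  have hV : ∀ v : V, 1 + (v : A) * v ∈ denominators L hLsq := fun v =>
    one_add_sq_mem_denominators L hLsq hL1 v (hb v)
  obtain ⟨C, _, _, ⟨D⟩⟩ := exists_fractionModel L hLsq
  obtain ⟨μ, _, _, ⟨R⟩⟩ := D.exists_randomCharacter V hgen hL1 hV
  have := compactSpace_posCharacter D.cone
  obtain ⟨α₀, -⟩ := hT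
  obtain ⟨ν, h1, h2, h3⟩ := R.exists_radonMeasure hQ ha α₀ hc
  exact ⟨ν, ⟨h1, h2, h3⟩, fun ν' h' =>
    representing_measure_unique V hgen hL1 hLsq hV h'.1 h1 h'.2.1 h2⟩
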